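/- arXiv:2409.03934 — 8 statements merged into one kernel-verified Lean document; each statement's English description precedes it below -/
import Mathlib

section
/- For every t ∈ ℝ and every z₀ ∈ ℝ, the planar vector ∑_{j=1}^{n} mⱼ qⱼ(t)/(‖qⱼ(t)‖² + z₀²)^{3/2} is zero. (In particular, the gravitational force exerted by the primaries on a particle located on the Z-axis points along the Z-axis.) -/
open Real Finset

/-- Rotation of the plane (identified with `ℂ`) by angle `θ`, i.e. `e^{θJ}`. -/
noncomputable def rot (θ : ℝ) (p : ℂ) : ℂ := Complex.exp ((θ : ℂ) * Complex.I) * p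

/-- If the primaries admit the polygonal symmetry
`q_{ζ(j)}(t) = e^{(2π/d)J} q_j(t)`, `m_{ζ(j)} = m_j`, then the planar component of the
gravitational force exerted on a particle on the `Z`-axis vanishes:
`∑ⱼ mⱼ qⱼ(t)/(‖qⱼ(t)‖² + z₀²)^{3/2} = 0`. -/
theorem planar_force_vanishes_on_axis
    (n d : ℕ) (hn : 2 ≤ n) (hd : 2 ≤ d)
    (m : Fin n → ℝ) (hm : ∀ j, 0 < m j)
    (q : Fin n → ℝ → ℂ)
    (hq : ∀ j, ∀ t : ℝ, 0 < ‖q j t‖)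
    (ζ : Equiv.Perm (Fin n))
    (hmass : ∀ j, m (ζ j) = m j)
    (hrot : ∀ j, ∀ t : ℝ, q (ζ j) t = rot (2 * π / d) (q j t)) :
    ∀ (t z₀ : ℝ),
      ∑ j, (m j / ((‖q j t‖ ^ 2 + z₀ ^ 2) ^ (3 / 2 : ℝ))) • q j t = 0 := by
  intro t z₀
  have hω : Complex.exp (((2 * π / d : ℝ) : ℂ) * Complex.I) ≠ 1 := by
    have h := (Complex.isPrimitiveRoot_exp d (by omega)).ne_one (by omega)
    intro h2
    apply h
    rw [← h2]
    congr 1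
    push_cast
    ring
  have hnorm : ∀ j, ‖q (ζ j) t‖ = ‖q j t‖ := by
    intro j
    rw [hrot, rot, norm_mul, Complex.norm_exp_ofReal_mul_I, one_mul]
  have key : Complex.exp (((2 * π / d : ℝ) : ℂ) * Complex.I) *
      (∑ j, (m j / ((‖q j t‖ ^ 2 + z₀ ^ 2) ^ (3 / 2 : ℝ))) • q j t) =
      ∑ j, (m j / ((‖q j t‖ ^ 2 + z₀ ^ 2) ^ (3 / 2 : ℝ))) • q j t := by
    conv_rhs => rw [← Equiv.sum_comp ζ]
    rw [Finset.mul_sum]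
    refine Finset.sum_congr rfl fun j _ => ?_
    rw [hnorm, hmass, hrot, rot, mul_smul_comm]
  by_contra hS
  exact hω (mul_right_cancel₀ hS (key.trans (one_mul _).symm))
end

section
/- Let T > 0 and let z : ℝ → ℝ be a C² T-periodic function such that z(t)² + ż(t)² > 0 for all t ∈ ℝ. Then z has finitely many zeros in [0, T), and their number equals (1/π) ∫₀^{T} (ż(t)² − z̈(t) z(t)) / (z(t)² + ż(t)²) dt. -/
open Real

/-- A function with positive derivative at each of its zeros stays positive once nonnegative. -/
lemma zc_pos_after (g g' : ℝ → ℝ) (hg : ∀ t, HasDerivAt g (g' t) t)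
    (hpos : ∀ t, g t = 0 → 0 < g' t) (s t : ℝ) (hst : s < t) (hs : 0 ≤ g s) : 0 < g t := by
  have hcont : Continuous g := continuous_iff_continuousAt.2 fun x => (hg x).continuousAt
  have h0 : ∀ x ∈ Set.Icc s t, 0 ≤ g x := by
    intro x hx
    exact image_le_of_deriv_right_lt_deriv_boundary' (f := fun _ => (0:ℝ)) (f' := fun _ => 0)
      (B := g) (B' := g') (a := s) (b := t) continuousOn_const
      (fun x _ => hasDerivWithinAt_const _ _ _) hs hcont.continuousOn
      (fun x _ => (hg x).hasDerivWithinAt) (fun x _ hx => hpos x hx.symm) hx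
  rcases (h0 t ⟨hst.le, le_rfl⟩).lt_or_eq with h | h
  · exact h
  exfalso
  have h1 := (hasDerivAt_iff_tendsto_slope.1 (hg t)).eventually (lt_mem_nhds (hpos t h.symm))
  have h2 : ∀ᶠ y in nhdsWithin t (Set.Iio t), 0 < slope g t y :=
    h1.filter_mono (nhdsWithin_mono t fun y hy => ne_of_lt hy)
  have h3 : ∀ᶠ y in nhdsWithin t (Set.Iio t), y ∈ Set.Ioo s t := Ioo_mem_nhdsLT hst
  obtain ⟨y, hy1, hy2⟩ := (h2.and h3).exists
  have h4 := h0 y ⟨hy2.1.le, hy2.2.le⟩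
  rw [slope_def_field, ← h, sub_zero] at hy1
  have : g y / (y - t) ≤ 0 := div_nonpos_of_nonneg_of_nonpos h4 (by linarith [hy2.2])
  linarith

/-- Existence of a phase function. -/
lemma zc_phase (z : ℝ → ℝ) (hz : ContDiff ℝ 2 z)
    (hnd : ∀ t : ℝ, 0 < z t ^ 2 + deriv z t ^ 2) (f : ℝ → ℝ)
    (hf : f = fun t => (deriv z t ^ 2 - deriv (deriv z) t * z t) / (z t ^ 2 + deriv z t ^ 2)) :
    ∃ θ : ℝ → ℝ, (∀ t, HasDerivAt θ (f t) t) ∧ (∀ t, θ t - θ 0 = ∫ x in (0:ℝ)..t, f x) ∧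
      ∀ t, z t * cos (θ t) = deriv z t * sin (θ t) := by
  have hz1 : ContDiff ℝ 1 (deriv z) := by
    have : ContDiff ℝ (1 + 1) z := by simpa [one_add_one_eq_two] using hz
    exact (contDiff_succ_iff_deriv.1 this).2.2
  have hc2 : Continuous (deriv (deriv z)) := hz1.continuous_deriv le_rfl
  have hd : ∀ t, HasDerivAt z (deriv z t) t := fun t =>
    (hz.differentiable (by norm_num) t).hasDerivAt
  have hd1 : ∀ t, HasDerivAt (deriv z) (deriv (deriv z) t) t := fun t =>
    (hz1.differentiable (by norm_num) t).hasDerivAt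
  have hfc : Continuous f := by
    rw [hf]
    exact ((hz1.continuous.pow 2).sub (hc2.mul hz.continuous)).div
      ((hz.continuous.pow 2).add (hz1.continuous.pow 2)) fun t => (hnd t).ne'
  obtain ⟨a, ha⟩ : ∃ a : ℝ, z 0 * cos a = deriv z 0 * sin a := by
    refine ⟨Complex.arg ⟨deriv z 0, z 0⟩, ?_⟩
    have h1 := Complex.norm_mul_cos_arg ⟨deriv z 0, z 0⟩
    have h2 := Complex.norm_mul_sin_arg ⟨deriv z 0, z 0⟩
    simp only at h1 h2
    generalize Complex.arg ⟨deriv z 0, z 0⟩ = a at *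
    linear_combination sin a * h1 - cos a * h2
  let θ : ℝ → ℝ := fun t => a + ∫ x in (0:ℝ)..t, f x
  have hθ0 : θ 0 = a := by simp [θ]
  have hθ : ∀ t, HasDerivAt θ (f t) t := fun t =>
    ((hfc.integral_hasStrictDerivAt 0 t).hasDerivAt).const_add a
  refine ⟨θ, hθ, fun t => by rw [hθ0]; simp [θ], ?_⟩
  let A : ℝ → ℝ := fun t => z t * cos (θ t) - deriv z t * sin (θ t)
  let Q : ℝ → ℝ := fun t => A t ^ 2 / (z t ^ 2 + deriv z t ^ 2)
  have hQ : ∀ t, HasDerivAt Q 0 t := by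
    intro t
    have hA : HasDerivAt A _ t := ((hd t).mul (hθ t).cos).sub ((hd1 t).mul (hθ t).sin)
    have hr := ((hd t).pow 2).add ((hd1 t).pow 2)
    have hq := (hA.pow 2).div hr (hnd t).ne'
    refine hq.congr_deriv ?_
    have hft : f t * (z t ^ 2 + deriv z t ^ 2) = deriv z t ^ 2 - deriv (deriv z) t * z t := by
      rw [hf]; exact div_mul_cancel₀ _ (hnd t).ne'
    rw [div_eq_zero_iff]; left
    simp only [A, Pi.add_apply, Pi.pow_apply]
    generalize f t = F at *
    generalize deriv (deriv z) t = w at *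
    generalize deriv z t = y at *
    generalize z t = x at *
    generalize cos (θ t) = c at *
    generalize sin (θ t) = s at *
    push_cast
    linear_combination (-2 * (x * c - y * s) * (x * s + y * c)) * hft
  have hQ0 : Q 0 = 0 := by simp [Q, A, hθ0, ha]
  intro t
  have hQt : Q t = 0 := by
    rw [← hQ0]
    exact is_const_of_deriv_eq_zero (fun x => (hQ x).differentiableAt) (fun x => (hQ x).deriv) t 0
  have := (div_eq_zero_iff.1 hQt).resolve_right (hnd t).ne'
  have := pow_eq_zero_iff (two_ne_zero) |>.1 this
  exact sub_eq_zero.1 this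

/-- Integral formula for the number of zeros: if `z` is a `C²`
`T`-periodic function with `z² + ż² > 0` everywhere, then `z` has finitely many zeros
in `[0,T)` and their number equals
`(1/π) ∫₀ᵀ (ż² - z̈ z)/(z² + ż²) dt`. -/
theorem zero_count_formula
    (T : ℝ) (hT : 0 < T)
    (z : ℝ → ℝ) (hz : ContDiff ℝ 2 z)
    (hper : Function.Periodic z T)
    (hnd : ∀ t : ℝ, 0 < z t ^ 2 + deriv z t ^ 2) :
    {t ∈ Set.Ico (0 : ℝ) T | z t = 0}.Finite ∧
    ({t ∈ Set.Ico (0 : ℝ) T | z t = 0}.ncard : ℝ) =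
      (1 / π) * ∫ t in (0 : ℝ)..T,
        (deriv z t ^ 2 - deriv (deriv z) t * z t) / (z t ^ 2 + deriv z t ^ 2) := by
  obtain ⟨f, hf⟩ : ∃ f : ℝ → ℝ, f = fun t =>
    (deriv z t ^ 2 - deriv (deriv z) t * z t) / (z t ^ 2 + deriv z t ^ 2) := ⟨_, rfl⟩
  obtain ⟨θ, hθ, hint, hph⟩ := zc_phase z hz hnd f hf
  rw [← hf, ← hint T]
  have hzero : ∀ t, z t = 0 ↔ sin (θ t) = 0 := by
    intro t
    have h1 := hph t
    have h2 := hnd t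
    have h3 := sin_sq_add_cos_sq (θ t)
    constructor
    · intro h
      rw [h] at h1 h2
      rw [zero_mul] at h1
      rcases mul_eq_zero.1 h1.symm with h | h
      · rw [h] at h2; norm_num at h2
      · exact h
    · intro h
      rw [h] at h1 h3
      rw [mul_zero] at h1
      rcases mul_eq_zero.1 h1 with h | h
      · exact h
      · rw [h] at h3; norm_num at h3
  have hone : ∀ t, z t = 0 → f t = 1 := by
    intro t h
    have h2 := hnd t
    rw [hf]
    simp only [h] at h2 ⊢
    rw [mul_zero, sub_zero, div_eq_one_iff_eq h2.ne']
    ring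
  have hzn : ∀ t (n : ℤ), θ t = n * π → z t = 0 := fun t n h =>
    (hzero t).2 (sin_eq_zero_iff.2 ⟨n, h.symm⟩)
  have key : ∀ (n : ℤ) (s t : ℝ), s < t → n * π ≤ θ s → n * π < θ t := by
    intro n s t hst hs
    have := zc_pos_after (fun t => θ t - n * π) f (fun t => (hθ t).sub_const _)
      (fun t ht => by rw [hone t (hzn t n (sub_eq_zero.1 ht))]; norm_num) s t hst
      (sub_nonneg.2 hs)
    exact sub_pos.1 this
  have hcont : Continuous θ := continuous_iff_continuousAt.2 fun x => (hθ x).continuousAt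
  have hzT : z T = z 0 := by simpa using hper 0
  have hdT : deriv z T = deriv z 0 := by
    have h : (fun x => z (x + T)) = z := funext hper
    have h2 := deriv_comp_add_const z T 0
    rw [h, zero_add] at h2
    exact h2.symm
  obtain ⟨N, hN⟩ : ∃ N : ℤ, (N : ℝ) * π = θ T - θ 0 := by
    apply sin_eq_zero_iff.1
    rw [sin_sub]
    have h1 := hph 0
    have h2 := hph T
    rw [hzT, hdT] at h2
    have h0 := hnd 0
    by_cases h : z 0 = 0
    · have hd : deriv z 0 ≠ 0 := by
        intro h'; rw [h, h'] at h0; norm_num at h0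
      apply mul_left_cancel₀ hd
      linear_combination cos (θ T) * h1 - cos (θ 0) * h2
    · apply mul_left_cancel₀ h
      linear_combination sin (θ T) * h1 - sin (θ 0) * h2
  have hpi := pi_pos
  have hNnn : 0 ≤ N := by
    by_contra hneg
    have hN1 : (N : ℝ) ≤ -1 := by exact_mod_cast (by omega : N ≤ -1)
    have h1 : (⌊θ 0 / π⌋ : ℝ) * π ≤ θ 0 := (le_div_iff₀ hpi).1 (Int.floor_le _)
    have h2 : θ 0 < (⌊θ 0 / π⌋ + 1 : ℝ) * π := (div_lt_iff₀ hpi).1 (Int.lt_floor_add_one _)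
    have h3 := key _ 0 T hT h1
    nlinarith
  let m : ℤ := ⌈θ 0 / π⌉
  have hlo : ∀ n : ℤ, m ≤ n ↔ θ 0 ≤ n * π := fun n => by
    rw [Int.ceil_le, div_le_iff₀ hpi]
  have hhi : ∀ n : ℤ, n < m + N ↔ n * π < θ T := fun n => by
    rw [← sub_lt_iff_lt_add, Int.lt_ceil, lt_div_iff₀ hpi]
    push_cast
    constructor <;> intro h <;> linarith
  have hex : ∀ n : ℤ, ∃ t : ℝ, n ∈ Set.Ico m (m + N) → t ∈ Set.Ico (0:ℝ) T ∧ θ t = n * π := by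
    intro n
    by_cases hn : n ∈ Set.Ico m (m + N)
    · have h1 := (hlo n).1 hn.1
      have h2 := (hhi n).1 hn.2
      obtain ⟨t, ht, hte⟩ := intermediate_value_Icc hT.le hcont.continuousOn
        (show (n * π : ℝ) ∈ Set.Icc (θ 0) (θ T) from ⟨h1, h2.le⟩)
      refine ⟨t, fun _ => ⟨⟨ht.1, lt_of_le_of_ne ht.2 ?_⟩, hte⟩⟩
      rintro rfl
      linarith
    · exact ⟨0, fun h => absurd h hn⟩
  choose τ hτ using hex
  have hS : {t ∈ Set.Ico (0 : ℝ) T | z t = 0} = τ '' (Set.Ico m (m + N)) := by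
    ext t
    constructor
    · rintro ⟨ht, hzt⟩
      obtain ⟨n, hn⟩ := sin_eq_zero_iff.1 ((hzero t).1 hzt)
      have hm : n ∈ Set.Ico m (m + N) := by
        refine ⟨(hlo n).2 ?_, (hhi n).2 (key n t T ht.2 hn.le)⟩
        by_contra hlt
        push Not at hlt
        rcases ht.1.lt_or_eq with h | h
        · have := key n 0 t h hlt.le
          linarith
        · rw [h] at hlt; linarith
      refine ⟨n, hm, ?_⟩
      have h2 := (hτ n hm).2
      rcases lt_trichotomy (τ n) t with h | h | h
      · have := key n _ _ h h2.ge
        linarith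
      · exact h
      · have := key n _ _ h hn.le
        linarith
    · rintro ⟨n, hn, rfl⟩
      exact ⟨(hτ n hn).1, hzn _ n (hτ n hn).2⟩
  have hinj : Set.InjOn τ (Set.Ico m (m + N)) := by
    intro a ha b hb hab
    have h1 := (hτ a ha).2
    rw [hab, (hτ b hb).2] at h1
    have := mul_right_cancel₀ hpi.ne' h1
    exact_mod_cast this.symm
  rw [hS]
  refine ⟨(Set.finite_Ico _ _).image _, ?_⟩
  rw [hinj.ncard_image, ← Finset.coe_Ico, Set.ncard_coe_finset, Int.card_Ico, ← hN]
  have h1 : (((m + N - m).toNat : ℤ) : ℝ) = N := by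
    rw [Int.toNat_of_nonneg (by omega)]; push_cast; ring
  rw [Int.cast_natCast] at h1
  rw [h1]
  field_simp
end

section
/- Fix a positive integer 𝔮 and let z : ℝ × [0,1] → ℝ be continuous such that for each λ ∈ [0,1] the function z(·, λ) is C², 2π𝔮-periodic, not identically zero, and solves the parameterized Sitnikov equation ∂ₜ²z(t, λ) = −∑ⱼ mⱼ z(t, λ)/(ρⱼ(t;λ)² + z(t, λ)²)^{3/2}. Then the number of zeros of z(·, λ) in [0, 2π𝔮) is finite and does not depend on λ. -/
open Real Finset

namespace SitnikovAux

open Set Filter Topology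

lemma vanish {f : ℝ → ℝ} {A x y a c : ℝ} (hf : Differentiable ℝ f)
    (hf' : Differentiable ℝ (deriv f)) (hA : ∀ t, |deriv (deriv f) t| ≤ A * |f t|)
    (hA0 : 0 ≤ A)
    (ha : a ∈ Icc x y) (hc : c ∈ Icc x y) (hfa : f a = 0) (hfc : deriv f c = 0)
    (hs : A * (y - x) ^ 2 < 1) : ∀ t ∈ Icc x y, f t = 0 := by
  obtain ⟨p, hp, hmax⟩ := isCompact_Icc.exists_isMaxOn ⟨a, ha⟩
    (hf.continuous.abs.continuousOn (s := Icc x y))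
  have hmax' : ∀ t ∈ Icc x y, |f t| ≤ |f p| := fun t ht => hmax ht
  have hdist : ∀ u ∈ Icc x y, ∀ v ∈ Icc x y, |u - v| ≤ y - x := by
    intro u hu v hv
    rw [abs_le]; constructor <;> linarith [hu.1, hu.2, hv.1, hv.2]
  have hMnn : 0 ≤ |f p| := abs_nonneg _
  have h1 : ∀ t ∈ Icc x y, |deriv f t| ≤ A * |f p| * (y - x) := by
    intro t ht
    have := (convex_Icc x y).norm_image_sub_le_of_norm_deriv_le (f := deriv f)
      (C := A * |f p|) (fun u _ => hf' u)
      (fun u hu => (hA u).trans (mul_le_mul_of_nonneg_left (hmax' u hu) hA0)) hc ht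
    rw [hfc, sub_zero, Real.norm_eq_abs, Real.norm_eq_abs] at this
    exact this.trans (mul_le_mul_of_nonneg_left (hdist t ht c hc) (by positivity))
  have hyx : 0 ≤ y - x := by linarith [ha.1, ha.2]
  have h2 : |f p| ≤ A * |f p| * (y - x) * (y - x) := by
    have := (convex_Icc x y).norm_image_sub_le_of_norm_deriv_le (f := f)
      (C := A * |f p| * (y - x)) (fun u _ => hf u)
      (fun u hu => h1 u hu) ha hp
    rw [hfa, sub_zero, Real.norm_eq_abs, Real.norm_eq_abs] at this
    exact this.trans (mul_le_mul_of_nonneg_left (hdist p hp a ha) (by positivity))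
  have h3 : |f p| ≤ 0 := by
    by_contra hcon
    push Not at hcon
    nlinarith
  intro t ht
  exact abs_nonpos_iff.mp ((hmax' t ht).trans h3)

lemma unique {f : ℝ → ℝ} {A a δ : ℝ} (hf : Differentiable ℝ f)
    (hf' : Differentiable ℝ (deriv f)) (hA : ∀ t, |deriv (deriv f) t| ≤ A * |f t|)
    (hA0 : 0 ≤ A) (hδ : 0 < δ) (hAδ : A * δ ^ 2 < 1)
    (hfa : f a = 0) (hfa' : deriv f a = 0) : ∀ t, f t = 0 := by
  have hclopen : IsClopen {t | f t = 0 ∧ deriv f t = 0} := by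
    constructor
    · exact (isClosed_eq hf.continuous continuous_const).inter
        (isClosed_eq hf'.continuous continuous_const)
    · rw [isOpen_iff_mem_nhds]
      rintro t ⟨h0, h1⟩
      have hv := vanish (x := t - δ / 2) (y := t + δ / 2) hf hf' hA hA0
        ⟨by linarith, by linarith⟩ ⟨by linarith, by linarith⟩ h0 h1
        (by ring_nf; ring_nf at hAδ; exact hAδ)
      have hn : Ioo (t - δ / 2) (t + δ / 2) ∈ 𝓝 t :=
        Ioo_mem_nhds (by linarith) (by linarith)
      filter_upwards [hn] with u hu
      refine ⟨hv u (Ioo_subset_Icc_self hu), ?_⟩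
      have : f =ᶠ[𝓝 u] fun _ => 0 := by
        filter_upwards [Ioo_mem_nhds hu.1 hu.2] with r hr
        exact hv r (Ioo_subset_Icc_self hr)
      rw [this.deriv_eq]; simp
  have := hclopen.eq_univ ⟨a, hfa, hfa'⟩
  intro t
  have ht : t ∈ {t | f t = 0 ∧ deriv f t = 0} := this ▸ mem_univ t
  exact ht.1

lemma spacing {f : ℝ → ℝ} {A δ : ℝ} (hf : Differentiable ℝ f)
    (hf' : Differentiable ℝ (deriv f)) (hA : ∀ t, |deriv (deriv f) t| ≤ A * |f t|)
    (hA0 : 0 ≤ A) (hδ : 0 < δ) (hAδ : A * δ ^ 2 < 1) (hnz : ¬ ∀ t, f t = 0)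
    {a b : ℝ} (hab : a < b) (ha : f a = 0) (hb : f b = 0) : δ ≤ b - a := by
  by_contra hcon
  push Not at hcon
  obtain ⟨c, hc, hc'⟩ := exists_deriv_eq_zero hab hf.continuous.continuousOn (ha.trans hb.symm)
  have hlt : A * (b - a) ^ 2 < 1 := by
    have : (b - a) ^ 2 ≤ δ ^ 2 := by
      apply pow_le_pow_left₀ <;> linarith
    nlinarith
  have hv := vanish hf hf' hA hA0 (x := a) (y := b) (left_mem_Icc.2 hab.le)
    (Ioo_subset_Icc_self hc) ha hc' hlt
  exact hnz (unique hf hf' hA hA0 hδ hAδ (hv c (Ioo_subset_Icc_self hc)) hc')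

lemma not_pos_pos {f : ℝ → ℝ} {A δ ε t : ℝ} (hf : Differentiable ℝ f)
    (hf' : Differentiable ℝ (deriv f)) (hA : ∀ t, |deriv (deriv f) t| ≤ A * |f t|)
    (hA0 : 0 ≤ A) (hAδ : A * δ ^ 2 < 1)
    (hε : 0 < ε) (hεδ : 2 * ε < δ) (ht : f t = 0) (h1 : 0 < f (t - ε))
    (h2 : 0 < f (t + ε)) : False := by
  have htm : t ∈ Icc (t - ε) (t + ε) := ⟨by linarith, by linarith⟩
  obtain ⟨p, hp, hmin⟩ := isCompact_Icc.exists_isMinOn ⟨t, htm⟩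
    (hf.continuous.continuousOn (s := Icc (t - ε) (t + ε)))
  have hpt : f p ≤ f t := hmin htm
  have hp1 : t - ε < p := lt_of_le_of_ne hp.1 (by rintro rfl; linarith)
  have hp2 : p < t + ε := lt_of_le_of_ne hp.2 (by rintro rfl; linarith)
  have hd : deriv f p = 0 := (hmin.isLocalMin (Icc_mem_nhds hp1 hp2)).deriv_eq_zero
  have hlt : A * ((t + ε) - (t - ε)) ^ 2 < 1 := by
    have : ((t + ε) - (t - ε)) ^ 2 ≤ δ ^ 2 := by
      apply pow_le_pow_left₀ <;> linarith
    nlinarith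
  have := vanish hf hf' hA hA0 htm hp ht hd hlt (t - ε) ⟨le_rfl, by linarith⟩
  linarith

lemma signs {f : ℝ → ℝ} {A δ ε t : ℝ} (hf : Differentiable ℝ f)
    (hf' : Differentiable ℝ (deriv f)) (hA : ∀ t, |deriv (deriv f) t| ≤ A * |f t|)
    (hA0 : 0 ≤ A) (hδ : 0 < δ) (hAδ : A * δ ^ 2 < 1) (hnz : ¬ ∀ t, f t = 0)
    (hε : 0 < ε) (hεδ : 2 * ε < δ) (ht : f t = 0) : f (t - ε) * f (t + ε) < 0 := by
  have n1 : f (t - ε) ≠ 0 := fun h => by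
    have := spacing hf hf' hA hA0 hδ hAδ hnz (a := t - ε) (b := t) (by linarith) h ht
    linarith
  have n2 : f (t + ε) ≠ 0 := fun h => by
    have := spacing hf hf' hA hA0 hδ hAδ hnz (a := t) (b := t + ε) (by linarith) ht h
    linarith
  rcases lt_or_gt_of_ne n1 with h1 | h1 <;> rcases lt_or_gt_of_ne n2 with h2 | h2
  · exfalso
    have hd : deriv (-f) = -deriv f := by ext u; simp [deriv.neg]
    have hd2 : deriv (deriv (-f)) = -deriv (deriv f) := by
      rw [hd]; ext u; simp [deriv.neg]
    refine not_pos_pos (f := -f) (A := A) (δ := δ) (ε := ε) (t := t) hf.neg ?_ ?_ hA0 hAδ hε hεδ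
      ?_ ?_ ?_
    · rw [hd]; exact hf'.neg
    · intro u; rw [hd2]; simpa using hA u
    · simpa using ht
    · simpa using h1
    · simpa using h2
  · exact mul_neg_of_neg_of_pos h1 h2
  · exact mul_neg_of_pos_of_neg h1 h2
  · exact (not_pos_pos hf hf' hA hA0 hAδ hε hεδ ht h1 h2).elim

lemma finite_zeros {f : ℝ → ℝ} {δ : ℝ} (hδ : 0 < δ)
    (hsp : ∀ a b, a < b → f a = 0 → f b = 0 → δ ≤ b - a) (x y : ℝ) :
    {t ∈ Ico x y | f t = 0}.Finite := by
  refine Set.Finite.of_injOn (f := fun t => ⌊t / δ⌋) (t := Set.Icc ⌊x / δ⌋ ⌊y / δ⌋) ?_ ?_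
    (Set.finite_Icc _ _)
  · rintro t ⟨ht, -⟩
    exact ⟨Int.floor_le_floor (div_le_div_of_nonneg_right ht.1 hδ.le),
      Int.floor_le_floor (div_le_div_of_nonneg_right ht.2.le hδ.le)⟩
  · rintro a ⟨-, ha⟩ b ⟨-, hb⟩ hab
    have h := Int.abs_sub_lt_one_of_floor_eq_floor hab
    rw [← sub_div, abs_div, abs_of_pos hδ, div_lt_one hδ, abs_lt] at h
    rcases lt_trichotomy a b with hl | hl | hl
    · linarith [hsp a b hl ha hb]
    · exact hl
    · linarith [hsp b a hl hb ha]

lemma ncard_shift {f : ℝ → ℝ} {T : ℝ} (hT : 0 < T) (hf : Function.Periodic f T) (s : ℝ) :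
    {t ∈ Ico 0 T | f t = 0}.ncard = {t ∈ Ico s (s + T) | f t = 0}.ncard := by
  have key : ∀ a t, f (toIcoMod hT a t) = f t := by
    intro a t
    rw [toIcoMod]
    exact hf.sub_zsmul_eq _
  refine Set.ncard_congr (fun t _ => toIcoMod hT s t) ?_ ?_ ?_
  · rintro t ⟨-, h⟩
    exact ⟨toIcoMod_mem_Ico hT s t, (key s t).trans h⟩
  · rintro a b ⟨ha, -⟩ ⟨hb, -⟩ hab
    have h := congrArg (toIcoMod hT 0) hab
    simp only [toIcoMod_toIcoMod] at h
    rwa [(toIcoMod_eq_self hT).2 (by simpa using ha),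
      (toIcoMod_eq_self hT).2 (by simpa using hb)] at h
  · rintro b ⟨hb, h⟩
    refine ⟨toIcoMod hT 0 b, ⟨by simpa using toIcoMod_mem_Ico hT 0 b, (key 0 b).trans h⟩, ?_⟩
    simp only [toIcoMod_toIcoMod]
    exact (toIcoMod_eq_self hT).2 hb

lemma locConst {Λ : Type*} [TopologicalSpace Λ] {w : ℝ → Λ → ℝ} {T δ : ℝ} (hT : 0 < T)
    (hδ : 0 < δ) (hw : Continuous fun p : ℝ × Λ => w p.1 p.2)
    (hper : ∀ l, Function.Periodic (fun t => w t l) T)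
    (hnz : ∀ l, ¬ ∀ t, w t l = 0)
    (hsp : ∀ l a b, a < b → w a l = 0 → w b l = 0 → δ ≤ b - a)
    (hsg : ∀ l t ε, 0 < ε → 2 * ε < δ → w t l = 0 → w (t - ε) l * w (t + ε) l < 0) :
    IsLocallyConstant fun l => {t ∈ Ico 0 T | w t l = 0}.ncard := by
  have hsp' : ∀ l a b, w a l = 0 → w b l = 0 → |a - b| < δ → a = b := by
    intro l a b ha hb hab
    rw [abs_lt] at hab
    rcases lt_trichotomy a b with hl | hl | hl
    · linarith [hsp l a b hl ha hb]
    · exact hl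
    · linarith [hsp l b a hl hb ha]
  rw [IsLocallyConstant.iff_eventually_eq]
  intro l₀
  obtain ⟨s, hs⟩ := not_forall.1 (hnz l₀)
  have hfin := finite_zeros (f := fun t => w t l₀) hδ (hsp l₀) s (s + T)
  set Z := {t ∈ Ico s (s + T) | w t l₀ = 0} with hZ
  have hmem : ∀ t ∈ Z, s < t := by
    rintro t ⟨ht, h0⟩
    exact lt_of_le_of_ne ht.1 (by rintro rfl; exact hs h0)
  have hεe : ∀ᶠ ε in 𝓝[>] (0 : ℝ), (0 < ε ∧ ε < δ / 2) ∧ ∀ t ∈ Z, ε < t - s ∧ ε < s + T - t := by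
    have small : ∀ r : ℝ, 0 < r → ∀ᶠ ε in 𝓝[>] (0 : ℝ), ε < r := fun r hr =>
      nhdsWithin_le_nhds (Iio_mem_nhds hr)
    refine ((eventually_mem_nhdsWithin).and (small _ (by linarith))).and ?_
    rw [eventually_all_finite hfin]
    intro t ht
    exact (small _ (by linarith [hmem t ht])).and (small _ (by linarith [ht.1.2]))
  obtain ⟨ε, ⟨hε, hεδ⟩, hεZ⟩ := hεe.exists
  have hcl : ∀ t, Continuous fun l => w t l := fun t => hw.comp (Continuous.prodMk_right t)
  have hct : ∀ l, Continuous fun t => w t l := fun l => hw.comp (Continuous.prodMk_left l)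
  have e1 : ∀ᶠ l in 𝓝 l₀, ∀ t ∈ Z, w (t - ε) l * w (t + ε) l < 0 := by
    rw [eventually_all_finite hfin]
    intro t ht
    exact ((hcl (t - ε)).mul (hcl (t + ε))).continuousAt.eventually_lt continuousAt_const
      (hsg l₀ t ε hε (by linarith) ht.2)
  have hK : IsCompact (Icc s (s + T) \ ⋃ t ∈ Z, Ioo (t - ε) (t + ε)) :=
    isCompact_Icc.diff (isOpen_biUnion fun _ _ => isOpen_Ioo)
  have e2 : ∀ᶠ l in 𝓝 l₀, ∀ x ∈ Icc s (s + T) \ ⋃ t ∈ Z, Ioo (t - ε) (t + ε), w x l ≠ 0 := by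
    refine hK.eventually_forall_of_forall_eventually ?_
    rintro x ⟨hx, hxn⟩
    refine (hw.comp continuous_swap).continuousAt.eventually_ne ?_
    intro h0
    change w x l₀ = 0 at h0
    have hxT : x ≠ s + T := by
      rintro rfl
      exact hs ((hper l₀ s).symm.trans h0)
    refine hxn (mem_biUnion (x := x) ⟨⟨hx.1, lt_of_le_of_ne hx.2 hxT⟩, h0⟩ ?_)
    exact ⟨by linarith, by linarith⟩
  filter_upwards [e1, e2] with l h1 h2
  rw [ncard_shift hT (hper l) s, ncard_shift hT (hper l₀) s]
  have hex : ∀ t ∈ Z, ∃ u ∈ Icc (t - ε) (t + ε), w u l = 0 := by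
    intro t ht
    have hle : t - ε ≤ t + ε := by linarith
    have hc := (hct l).continuousOn (s := Icc (t - ε) (t + ε))
    rcases mul_neg_iff.1 (h1 t ht) with ⟨ha, hb⟩ | ⟨ha, hb⟩
    · exact intermediate_value_Icc' hle hc ⟨hb.le, ha.le⟩
    · exact intermediate_value_Icc hle hc ⟨ha.le, hb.le⟩
  choose! g hg hg0 using hex
  symm
  refine Set.ncard_congr (fun t _ => g t) ?_ ?_ ?_
  · intro t ht
    have := hg t ht
    have := hεZ t ht
    exact ⟨⟨by linarith [(hg t ht).1], by linarith [(hg t ht).2]⟩, hg0 t ht⟩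
  · intro a b ha hb hab
    have ha' := hg a ha
    have hb' := hg b hb
    change g a = g b at hab
    rw [hab] at ha'
    by_contra hne
    rcases lt_or_gt_of_ne hne with hl | hl
    · have := hsp l₀ a b hl ha.2 hb.2
      linarith [ha'.1, ha'.2, hb'.1, hb'.2]
    · have := hsp l₀ b a hl hb.2 ha.2
      linarith [ha'.1, ha'.2, hb'.1, hb'.2]
  · rintro x ⟨hx, hx0⟩
    have hxU : x ∈ ⋃ t ∈ Z, Ioo (t - ε) (t + ε) := by
      by_contra hn
      exact h2 x ⟨⟨hx.1, hx.2.le⟩, hn⟩ hx0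
    obtain ⟨t, ht, hxt⟩ := mem_iUnion₂.1 hxU
    refine ⟨t, ht, hsp' l _ _ (hg0 t ht) hx0 ?_⟩
    rw [abs_lt]
    constructor <;> linarith [(hg t ht).1, (hg t ht).2, hxt.1, hxt.2]

end SitnikovAux

/-- Along a continuous family `z(·,λ)` of nontrivial `2π𝔮`-periodic
solutions of the parameterized Sitnikov equation, the number of zeros in `[0, 2π𝔮)` is
finite and independent of `λ ∈ [0,1]`. -/
theorem zeros_independent_of_lambda
    (n : ℕ) (hn : 2 ≤ n)
    (m : Fin n → ℝ) (hm : ∀ j, 0 < m j)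
    (q : Fin n → ℝ → ℂ)
    (hqc : ∀ j, Continuous (q j))
    (hper : ∀ j, Function.Periodic (q j) π)
    (hmin : ∀ j, ∀ t : ℝ, 0 < ‖q j t‖)
    (βv : Fin n → ℝ)
    (hβ : ∀ j, IsGreatest (Set.range fun t => ‖q j t‖) (βv j))
    (𝔮 : ℕ) (h𝔮 : 0 < 𝔮)
    (z : ℝ → ℝ → ℝ)
    (hcont : ContinuousOn (fun p : ℝ × ℝ => z p.1 p.2)
      (Set.univ ×ˢ Set.Icc (0 : ℝ) 1))
    (hC2 : ∀ lam ∈ Set.Icc (0 : ℝ) 1, ContDiff ℝ 2 (fun t => z t lam))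
    (hzper : ∀ lam ∈ Set.Icc (0 : ℝ) 1,
      Function.Periodic (fun t => z t lam) (2 * π * 𝔮))
    (hnz : ∀ lam ∈ Set.Icc (0 : ℝ) 1, ¬ ∀ t : ℝ, z t lam = 0)
    (heq : ∀ lam ∈ Set.Icc (0 : ℝ) 1, ∀ t : ℝ,
      deriv (deriv (fun s => z s lam)) t =
        -∑ j, m j * z t lam /
          ((((1 - lam) * βv j + lam * ‖q j t‖) ^ 2 + z t lam ^ 2) ^ (3 / 2 : ℝ))) :
    ∃ N : ℕ, ∀ lam ∈ Set.Icc (0 : ℝ) 1,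
      {t ∈ Set.Ico (0 : ℝ) (2 * π * 𝔮) | z t lam = 0}.Finite ∧
      {t ∈ Set.Ico (0 : ℝ) (2 * π * 𝔮) | z t lam = 0}.ncard = N := by
  have hlow : ∀ j, ∃ c : ℝ, 0 < c ∧ ∀ t, c ≤ ‖q j t‖ := by
    intro j
    obtain ⟨p, -, hp⟩ := (isCompact_Icc (a := (0 : ℝ)) (b := π)).exists_isMinOn
      ⟨0, le_rfl, pi_pos.le⟩ ((hqc j).norm.continuousOn)
    refine ⟨‖q j p‖, hmin j p, fun t => ?_⟩
    obtain ⟨y, hy, hty⟩ := (hper j).exists_mem_Ico₀ pi_pos t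
    rw [hty]
    exact hp (Set.Ico_subset_Icc_self hy)
  choose c hc hcq using hlow
  set A : ℝ := ∑ j, m j / ((c j ^ 2) ^ (3 / 2 : ℝ)) with hAdef
  have hcp : ∀ j, 0 < (c j ^ 2) ^ (3 / 2 : ℝ) := fun j => by
    have := hc j
    positivity
  have hA0 : 0 ≤ A := Finset.sum_nonneg fun j _ => (div_pos (hm j) (hcp j)).le
  have hA : ∀ lam ∈ Set.Icc (0 : ℝ) 1, ∀ t : ℝ,
      |deriv (deriv (fun s => z s lam)) t| ≤ A * |z t lam| := by
    intro lam hl t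
    rw [heq lam hl t, abs_neg, hAdef, Finset.sum_mul]
    refine (Finset.abs_sum_le_sum_abs _ _).trans (Finset.sum_le_sum fun j _ => ?_)
    have hβc : c j ≤ βv j := (hcq j 0).trans ((hβ j).2 ⟨0, rfl⟩)
    have hρ : c j ≤ (1 - lam) * βv j + lam * ‖q j t‖ := by
      nlinarith [hcq j t, hl.1, hl.2, hβc]
    have hden : (c j ^ 2) ^ (3 / 2 : ℝ) ≤
        ((((1 - lam) * βv j + lam * ‖q j t‖) ^ 2 + z t lam ^ 2) ^ (3 / 2 : ℝ)) := by
      apply Real.rpow_le_rpow (by positivity) _ (by norm_num)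
      have := pow_le_pow_left₀ (hc j).le hρ 2
      nlinarith [sq_nonneg (z t lam)]
    rw [abs_div, abs_mul, abs_of_pos (hm j), abs_of_pos ((hcp j).trans_le hden),
      div_mul_eq_mul_div]
    exact div_le_div_of_nonneg_left (mul_nonneg (hm j).le (abs_nonneg _)) (hcp j) hden
  obtain ⟨δ, hδ, hAδ⟩ : ∃ δ : ℝ, 0 < δ ∧ A * δ ^ 2 < 1 := by
    refine ⟨1 / (A + 1), by positivity, ?_⟩
    rw [div_pow, one_pow, mul_one_div, div_lt_one (by positivity)]
    nlinarith
  have hd1 : ∀ lam ∈ Set.Icc (0 : ℝ) 1, Differentiable ℝ (fun t => z t lam) :=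
    fun lam hl => (hC2 lam hl).differentiable (by norm_num)
  have hd2 : ∀ lam ∈ Set.Icc (0 : ℝ) 1, Differentiable ℝ (deriv (fun t => z t lam)) := by
    intro lam hl
    have h : ContDiff ℝ (1 + 1) (fun t => z t lam) := by
      have := hC2 lam hl
      norm_num
      exact this
    exact (contDiff_succ_iff_deriv.1 h).2.2.differentiable (by norm_num)
  have hT : 0 < 2 * π * (𝔮 : ℝ) := by
    have : (0 : ℝ) < 𝔮 := by exact_mod_cast h𝔮
    positivity
  have hsp : ∀ lam ∈ Set.Icc (0 : ℝ) 1, ∀ a b, a < b → z a lam = 0 → z b lam = 0 → δ ≤ b - a :=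
    fun lam hl a b hab ha hb => SitnikovAux.spacing (f := fun t => z t lam)
      (hd1 lam hl) (hd2 lam hl) (hA lam hl) hA0 hδ hAδ (hnz lam hl) hab ha hb
  have hw : Continuous fun p : ℝ × Set.Icc (0 : ℝ) 1 => z p.1 p.2 :=
    hcont.comp_continuous (f := fun p : ℝ × Set.Icc (0 : ℝ) 1 => (p.1, (p.2 : ℝ)))
      (by fun_prop) (fun p => ⟨trivial, p.2.2⟩)
  have hloc := SitnikovAux.locConst (Λ := Set.Icc (0 : ℝ) 1) (w := fun t l => z t l)
    hT hδ hw (fun l => hzper l l.2) (fun l => hnz l l.2) (fun l => hsp l l.2)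
    (fun l t ε hε hεδ ht => SitnikovAux.signs (f := fun t => z t l)
      (hd1 l l.2) (hd2 l l.2) (hA l l.2) hA0 hδ hAδ (hnz l l.2) hε hεδ ht)
  refine ⟨{t ∈ Set.Ico (0 : ℝ) (2 * π * 𝔮) | z t 0 = 0}.ncard, fun lam hl => ⟨?_, ?_⟩⟩
  · exact SitnikovAux.finite_zeros hδ (hsp lam hl) _ _
  · exact hloc.apply_eq_of_isPreconnected isPreconnected_univ
      (x := (⟨lam, hl⟩ : Set.Icc (0 : ℝ) 1)) (y := ⟨0, le_rfl, zero_le_one⟩) trivial trivial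
end

section
/- Let 𝔮 be a positive integer, 𝔭 a nonnegative integer, and F : [0, π𝔮] → ℝ a continuous function with 0 < m ≤ F(t) ≤ M for all t. Suppose η ∈ ℝ and z : [0, π𝔮] → ℝ is a C² function, not identically zero, satisfying −z̈(t) + z(t) = η F(t) z(t) on [0, π𝔮], ż(0) = ż(π𝔮) = 0, and having exactly 𝔭 zeros in the open interval (0, π𝔮). Then (1 + (𝔭/𝔮)²)/M ≤ η ≤ (1 + (𝔭/𝔮)²)/m. -/
open Real

lemma aux_stay (θ g : ℝ → ℝ) (L c a : ℝ) (ha : 0 ≤ a)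
    (hθ : ∀ t, HasDerivAt θ (g t) t)
    (hpos : ∀ t ∈ Set.Icc (0 : ℝ) L, θ t = c → 0 < g t) (hac : c ≤ θ a) :
    ∀ s, a < s → s ≤ L → c < θ s := by
  have key : ∀ s, a ≤ s → s ≤ L → c ≤ θ s := by
    intro s h1 h2
    have := image_le_of_deriv_right_lt_deriv_boundary (f := fun _ => c) (f' := fun _ => 0)
      (a := a) (b := L) continuousOn_const (fun x _ => (hasDerivWithinAt_const x _ c))
      (B := θ) (B' := g) hac hθ
      (fun x hx h => hpos x ⟨ha.trans hx.1, hx.2.le⟩ h.symm)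
    exact this ⟨h1, h2⟩
  intro s h1 h2
  refine lt_of_le_of_ne (key s h1.le h2) ?_
  intro h
  have hg := hpos s ⟨ha.trans h1.le, h2⟩ h.symm
  have hmin : ∀ᶠ x in nhdsWithin s (Set.Iio s), c ≤ θ x := by
    filter_upwards [Ioo_mem_nhdsLT h1] with x hx
    exact key x hx.1.le (hx.2.le.trans h2)
  have hsl := (hasDerivAt_iff_tendsto_slope.1 (hθ s)).mono_left
    (nhdsWithin_mono s (show Set.Iio s ⊆ {s}ᶜ from fun x hx => ne_of_lt hx))
  have hev := hsl.eventually (lt_mem_nhds hg)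
  obtain ⟨x, hx1, hx2, hx3⟩ := (hmin.and (hev.and self_mem_nhdsWithin)).exists
  rw [slope_def_field] at hx2
  have : (θ x - θ s) / (x - s) ≤ 0 :=
    div_nonpos_of_nonneg_of_nonpos (by linarith) (by have : x < s := hx3; linarith)
  linarith

lemma aux_count (θ g : ℝ → ℝ) (L : ℝ) (hL : 0 < L)
    (hθ : ∀ t, HasDerivAt θ (g t) t) (h0 : θ 0 = 0)
    (hpos : ∀ t ∈ Set.Icc (0 : ℝ) L, cos (θ t) = 0 → 0 < g t)
    (hsin : sin (θ L) = 0) :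
    θ L = ({t ∈ Set.Ioo (0 : ℝ) L | cos (θ t) = 0}.ncard : ℝ) * π := by
  have hpi := Real.pi_pos
  have hlev : ∀ k : ℤ, ∀ t ∈ Set.Icc (0 : ℝ) L, θ t = (2 * k + 1) * π / 2 → 0 < g t := by
    intro k t ht h
    exact hpos t ht (Real.cos_eq_zero_iff.2 ⟨k, h⟩)
  have hlow : ∀ s, 0 < s → s ≤ L → -(π / 2) < θ s := by
    intro s h1 h2
    have := aux_stay θ g L ((2 * (-1 : ℤ) + 1) * π / 2) 0 le_rfl hθ (hlev (-1))
      (by rw [h0]; push_cast; linarith) s h1 h2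
    push_cast at this
    linarith
  obtain ⟨n, hn⟩ := Real.sin_eq_zero_iff.1 hsin
  have hn0 : 0 ≤ n := by
    have := hlow L hL le_rfl
    rw [← hn] at this
    by_contra hneg
    have h1 : n ≤ -1 := by omega
    have h2 : (n : ℝ) ≤ -1 := by exact_mod_cast h1
    nlinarith
  lift n to ℕ using hn0
  have hcont : Continuous θ := continuous_iff_continuousAt.2 fun t => (hθ t).continuousAt
  set S := {t ∈ Set.Ioo (0 : ℝ) L | cos (θ t) = 0} with hS
  have hinj : Set.InjOn θ S := by
    have : ∀ x ∈ S, ∀ y ∈ S, x < y → θ x ≠ θ y := by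
      intro x hx y hy hxy h
      obtain ⟨k, hk⟩ := Real.cos_eq_zero_iff.1 hx.2
      have := aux_stay θ g L _ x hx.1.1.le hθ (hlev k) hk.ge y hxy hy.1.2.le
      linarith
    intro x hx y hy h
    rcases lt_trichotomy x y with h1 | h1 | h1
    · exact absurd h (this x hx y hy h1)
    · exact h1
    · exact absurd h.symm (this y hy x hx h1)
  have himg : θ '' S = (fun j : ℕ => (2 * (j : ℝ) + 1) * π / 2) '' (Finset.range n : Set ℕ) := by
    ext c
    constructor
    · rintro ⟨x, hx, rfl⟩
      obtain ⟨k, hk⟩ := Real.cos_eq_zero_iff.1 hx.2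
      have h1 := hlow x hx.1.1 hx.1.2.le
      have h2 := aux_stay θ g L _ x hx.1.1.le hθ (hlev k) hk.ge L hx.1.2 le_rfl
      rw [hk] at h1
      rw [← hn] at h2
      have hk0 : 0 ≤ k := by
        by_contra hneg
        have h3 : k ≤ -1 := by omega
        have h4 : (k : ℝ) ≤ -1 := by exact_mod_cast h3
        nlinarith
      lift k to ℕ using hk0
      refine ⟨k, ?_, ?_⟩
      · simp only [Finset.coe_range, Set.mem_Iio]
        by_contra hneg
        have h4 : (n : ℝ) ≤ k := by exact_mod_cast not_lt.1 hneg
        push_cast at h2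
        nlinarith
      · simpa using hk.symm
    · rintro ⟨j, hj, rfl⟩
      simp only [Finset.coe_range, Set.mem_Iio] at hj
      have hj' : (j : ℝ) + 1 ≤ n := by exact_mod_cast hj
      have hj0 : (0 : ℝ) ≤ j := Nat.cast_nonneg j
      have := intermediate_value_Ioo hL.le hcont.continuousOn
        (show (2 * (j : ℝ) + 1) * π / 2 ∈ Set.Ioo (θ 0) (θ L) by
          rw [h0, ← hn]
          constructor
          · positivity
          · push_cast; nlinarith)
      obtain ⟨x, hx, hxe⟩ := this
      exact ⟨x, ⟨hx, Real.cos_eq_zero_iff.2 ⟨j, by simpa using hxe⟩⟩, hxe⟩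
  have hcard : S.ncard = n := by
    rw [← Set.ncard_image_of_injOn hinj, himg, Set.ncard_image_of_injective,
      Set.ncard_coe_finset, Finset.card_range]
    intro a b h
    have h' : (2 * (a : ℝ) + 1) * π / 2 = (2 * (b : ℝ) + 1) * π / 2 := h
    have : (a : ℝ) = b := by
      have := mul_right_cancel₀ hpi.ne' (show (2 * (a : ℝ) + 1) * π = (2 * (b : ℝ) + 1) * π by linarith)
      linarith
    exact_mod_cast this
  rw [hcard, ← hn]
  simp

lemma aux_prufer (z z1 z2 : ℝ → ℝ) (L ω : ℝ) (hL : 0 < L) (hω : 0 < ω)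
    (h1 : ∀ t, HasDerivAt z (z1 t) t) (h2 : ∀ t, HasDerivAt z1 (z2 t) t)
    (hc : Continuous z2)
    (hR : ∀ t ∈ Set.Icc (0 : ℝ) L, 0 < ω ^ 2 * z t ^ 2 + z1 t ^ 2)
    (hb : z1 0 = 0) :
    ∃ θ g : ℝ → ℝ, (∀ t, HasDerivAt θ (g t) t) ∧ θ 0 = 0 ∧
      (∀ t ∈ Set.Icc (0 : ℝ) L,
        g t = ω * (z1 t ^ 2 - z t * z2 t) / (ω ^ 2 * z t ^ 2 + z1 t ^ 2)) ∧
      ∀ t ∈ Set.Icc (0 : ℝ) L, ∃ A : ℝ, A ≠ 0 ∧ ω * z t = A * cos (θ t) ∧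
        z1 t = -A * sin (θ t) := by
  have hz : Continuous z := continuous_iff_continuousAt.2 fun t => (h1 t).continuousAt
  have hz1 : Continuous z1 := continuous_iff_continuousAt.2 fun t => (h2 t).continuousAt
  set g0 : ℝ → ℝ := fun t =>
    ω * (z1 t ^ 2 - z t * z2 t) / (ω ^ 2 * z t ^ 2 + z1 t ^ 2) with hg0
  have hg0c : ContinuousOn g0 (Set.Icc 0 L) := by
    apply ContinuousOn.div
    · fun_prop
    · fun_prop
    · intro t ht; exact (hR t ht).ne'
  set g : ℝ → ℝ := Set.IccExtend hL.le ((Set.Icc 0 L).restrict g0) with hg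
  have hgc : Continuous g := (hg0c.restrict).Icc_extend'
  have hgg : ∀ t ∈ Set.Icc (0 : ℝ) L, g t = g0 t := by
    intro t ht
    rw [hg, Set.IccExtend_of_mem hL.le _ ht]; rfl
  have hθ : ∀ t, HasDerivAt (fun t => ∫ s in (0 : ℝ)..t, g s) (g t) t := fun t =>
    hgc.integral_hasStrictDerivAt 0 t |>.hasDerivAt
  generalize hθdef : (fun t => ∫ s in (0 : ℝ)..t, g s) = θ at hθ
  have hθ0 : θ 0 = 0 := by rw [← hθdef]; simp
  refine ⟨θ, g, hθ, hθ0, hgg, ?_⟩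
  set B : ℝ → ℝ := fun t => ω * z t * sin (θ t) + z1 t * cos (θ t) with hB
  set R : ℝ → ℝ := fun t => ω ^ 2 * z t ^ 2 + z1 t ^ 2 with hRd
  have hBd : ∀ t, HasDerivAt B (ω * z1 t * sin (θ t) + ω * z t * (cos (θ t) * g t)
      + (z2 t * cos (θ t) + z1 t * (-sin (θ t) * g t))) t := by
    intro t
    exact (((h1 t).const_mul ω).mul (hθ t).sin).add ((h2 t).mul (hθ t).cos)
  have hRdd : ∀ t, HasDerivAt R (ω ^ 2 * (2 * z t * z1 t) + 2 * z1 t * z2 t) t := by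
    intro t
    have := (((h1 t).pow 2).const_mul (ω ^ 2)).add ((h2 t).pow 2)
    exact this.congr_deriv (by norm_num)
  have hq : ∀ t ∈ Set.Icc (0 : ℝ) L, HasDerivAt (fun t => B t ^ 2 / R t) 0 t := by
    intro t ht
    have hRt : R t ≠ 0 := (hR t ht).ne'
    have := ((hBd t).pow 2).div (hRdd t) hRt
    refine this.congr_deriv ?_
    have hgt : g t * R t = ω * (z1 t ^ 2 - z t * z2 t) := by
      rw [hgg t ht]; simp only [hg0, hRd]; rw [div_mul_cancel₀ _ (hR t ht).ne']
    have key : (ω * z1 t * sin (θ t) + ω * z t * (cos (θ t) * g t)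
      + (z2 t * cos (θ t) + z1 t * (-sin (θ t) * g t))) * R t =
        B t * (ω ^ 2 * (z t * z1 t) + z1 t * z2 t) := by
      calc _ = (ω * z1 t * sin (θ t) + z2 t * cos (θ t)) * R t
            + (ω * z t * cos (θ t) - z1 t * sin (θ t)) * (g t * R t) := by ring
        _ = _ := by rw [hgt]; simp only [hB, hRd]; ring
    rw [div_eq_zero_iff]; left
    simp only [Nat.cast_ofNat, Nat.add_one_sub_one, pow_one, Pi.pow_apply]
    linear_combination 2 * B t * key
  intro t ht
  have hconst : B t ^ 2 / R t = B 0 ^ 2 / R 0 := by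
    have := constant_of_has_deriv_right_zero (f := fun t => B t ^ 2 / R t) (a := 0) (b := L)
      (fun x hx => (hq x hx).continuousAt.continuousWithinAt)
      (fun x hx => (hq x ⟨hx.1, hx.2.le⟩).hasDerivWithinAt)
    exact this t ht
  have hB0 : B 0 = 0 := by simp [hB, hθ0, hb]
  have hBt : B t = 0 := by
    rw [hB0] at hconst
    have hRt : R t ≠ 0 := (hR t ht).ne'
    simpa [hRt] using hconst
  have hsc := Real.sin_sq_add_cos_sq (θ t)
  have hBt' : ω * z t * sin (θ t) + z1 t * cos (θ t) = 0 := hBt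
  have e1 : ω * z t = (ω * z t * cos (θ t) - z1 t * sin (θ t)) * cos (θ t) := by
    linear_combination (-ω * z t) * hsc + sin (θ t) * hBt'
  have e2 : z1 t = -(ω * z t * cos (θ t) - z1 t * sin (θ t)) * sin (θ t) := by
    linear_combination (-z1 t) * hsc + cos (θ t) * hBt'
  refine ⟨ω * z t * cos (θ t) - z1 t * sin (θ t), ?_, e1, e2⟩
  intro hA
  rw [hA] at e1 e2
  have := hR t ht
  have e3 : ω ^ 2 * z t ^ 2 + z1 t ^ 2 = 0 := by
    rw [← mul_pow, e1, e2]; ring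
  linarith

lemma aux_unique (z z1 z2 : ℝ → ℝ) (L C : ℝ)
    (h1 : ∀ t, HasDerivAt z (z1 t) t) (h2 : ∀ t, HasDerivAt z1 (z2 t) t)
    (hC : ∀ t ∈ Set.Icc (0 : ℝ) L, |2 * z t * z1 t + 2 * z1 t * z2 t| ≤ C * (z t ^ 2 + z1 t ^ 2))
    (s : ℝ) (hs : s ∈ Set.Icc (0 : ℝ) L) (hs0 : z s = 0) (hs1 : z1 s = 0) :
    ∀ t ∈ Set.Icc (0 : ℝ) L, z t = 0 := by
  have hE : ∀ t, HasDerivAt (fun t => z t ^ 2 + z1 t ^ 2) (2 * z t * z1 t + 2 * z1 t * z2 t) t := by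
    intro t
    have := ((h1 t).pow 2).add ((h2 t).pow 2)
    exact this.congr_deriv (by norm_num)
  have hP : ∀ k t, HasDerivAt (fun t => (z t ^ 2 + z1 t ^ 2) * exp (k * t))
      ((2 * z t * z1 t + 2 * z1 t * z2 t) * exp (k * t)
        + (z t ^ 2 + z1 t ^ 2) * (exp (k * t) * k)) t := by
    intro k t
    have h := ((hasDerivAt_id t).const_mul k).exp
    simp only [id, mul_one] at h
    exact (hE t).mul h
  have hmono : MonotoneOn (fun t => (z t ^ 2 + z1 t ^ 2) * exp (C * t)) (Set.Icc 0 L) := by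
    apply monotoneOn_of_deriv_nonneg (convex_Icc 0 L)
    · exact fun x _ => (hP C x).continuousAt.continuousWithinAt
    · exact fun x _ => (hP C x).differentiableAt.differentiableWithinAt
    · intro x hx
      rw [(hP C x).deriv]
      have := (abs_le.1 (hC x (interior_subset hx))).1
      have he := exp_pos (C * x)
      nlinarith
  have hanti : AntitoneOn (fun t => (z t ^ 2 + z1 t ^ 2) * exp (-C * t)) (Set.Icc 0 L) := by
    apply antitoneOn_of_deriv_nonpos (convex_Icc 0 L)
    · exact fun x _ => (hP (-C) x).continuousAt.continuousWithinAt
    · exact fun x _ => (hP (-C) x).differentiableAt.differentiableWithinAt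
    · intro x hx
      rw [(hP (-C) x).deriv]
      have := (abs_le.1 (hC x (interior_subset hx))).2
      have he := exp_pos (-C * x)
      nlinarith
  intro t ht
  have : z t ^ 2 + z1 t ^ 2 ≤ 0 := by
    rcases le_total t s with h | h
    · have := hmono ht hs h
      simp only [hs0, hs1] at this
      have he := exp_pos (C * t)
      by_contra hc
      nlinarith [mul_pos (not_le.1 hc) he]
    · have := hanti hs ht h
      simp only [hs0, hs1] at this
      have he := exp_pos (-C * t)
      by_contra hc
      nlinarith [mul_pos (not_le.1 hc) he]
  have : z t ^ 2 = 0 := le_antisymm (by nlinarith [sq_nonneg (z1 t)]) (sq_nonneg _)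
  exact pow_eq_zero_iff (two_ne_zero) |>.1 this

/-- Comparison of Sturm–Liouville eigenvalues: if a nontrivial
solution of `-z̈ + z = ηF(t)z` with Neumann conditions on `[0, π𝔮]` has exactly `𝔭`
zeros in `(0, π𝔮)` and `0 < m ≤ F ≤ M`, then
`(1 + (𝔭/𝔮)²)/M ≤ η ≤ (1 + (𝔭/𝔮)²)/m`. -/
theorem sturm_liouville_eigenvalue_comparison
    (𝔮 : ℕ) (h𝔮 : 0 < 𝔮) (𝔭 : ℕ)
    (F : ℝ → ℝ) (hF : ContinuousOn F (Set.Icc (0 : ℝ) (π * 𝔮)))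
    (m M : ℝ) (hm : 0 < m)
    (hbounds : ∀ t ∈ Set.Icc (0 : ℝ) (π * 𝔮), m ≤ F t ∧ F t ≤ M)
    (η : ℝ) (z : ℝ → ℝ) (hz : ContDiff ℝ 2 z)
    (hnz : ¬ ∀ t ∈ Set.Icc (0 : ℝ) (π * 𝔮), z t = 0)
    (heq : ∀ t ∈ Set.Icc (0 : ℝ) (π * 𝔮),
      -deriv (deriv z) t + z t = η * F t * z t)
    (hbc0 : deriv z 0 = 0) (hbc1 : deriv z (π * 𝔮) = 0)
    (hzeros : {t ∈ Set.Ioo (0 : ℝ) (π * 𝔮) | z t = 0}.Finite ∧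
      {t ∈ Set.Ioo (0 : ℝ) (π * 𝔮) | z t = 0}.ncard = 𝔭) :
    (1 + ((𝔭 : ℝ) / 𝔮) ^ 2) / M ≤ η ∧ η ≤ (1 + ((𝔭 : ℝ) / 𝔮) ^ 2) / m := by
  have hq' : (0 : ℝ) < 𝔮 := by exact_mod_cast h𝔮
  have hpi := Real.pi_pos
  set L : ℝ := π * 𝔮 with hLdef
  have hL : 0 < L := by positivity
  have hM : 0 < M := by
    have := hbounds 0 ⟨le_rfl, hL.le⟩
    linarith [this.1, this.2]
  set z1 := deriv z with hz1
  set z2 := deriv z1 with hz2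
  have hz1c : ContDiff ℝ 1 z1 := by
    have : ContDiff ℝ (1 + 1) z := by simpa [one_add_one_eq_two] using hz
    exact (contDiff_succ_iff_deriv.1 this).2.2
  have h1 : ∀ t, HasDerivAt z (z1 t) t := fun t =>
    (hz.differentiable (by norm_num) t).hasDerivAt
  have h2 : ∀ t, HasDerivAt z1 (z2 t) t := fun t =>
    (hz1c.differentiable (by norm_num) t).hasDerivAt
  have hz2c : Continuous z2 := hz1c.continuous_deriv (by norm_num)
  have heq' : ∀ t ∈ Set.Icc (0 : ℝ) L, z2 t = (1 - η * F t) * z t := by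
    intro t ht
    linarith [heq t ht]
  -- nondegeneracy
  have hnd : ∀ t ∈ Set.Icc (0 : ℝ) L, ¬ (z t = 0 ∧ z1 t = 0) := by
    rintro s hs ⟨ha, hb⟩
    refine hnz (aux_unique z z1 z2 L (2 + |η| * M) h1 h2 ?_ s hs ha hb)
    intro t ht
    rw [heq' t ht]
    have hFt := hbounds t ht
    have e : 2 * z t * z1 t + 2 * z1 t * ((1 - η * F t) * z t)
        = (2 - η * F t) * (2 * z t * z1 t) := by ring
    rw [e, abs_mul]
    apply mul_le_mul
    · calc |2 - η * F t| ≤ |2| + |η * F t| := abs_sub _ _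
        _ ≤ 2 + |η| * M := by
          rw [abs_mul, abs_of_pos (show (0 : ℝ) < 2 by norm_num),
            abs_of_pos (show 0 < F t by linarith [hFt.1])]
          gcongr
          exact hFt.2
    · rw [abs_le]
      constructor <;> nlinarith [sq_nonneg (z t + z1 t), sq_nonneg (z t - z1 t)]
    · positivity
    · positivity
  -- energy
  have hen : ¬ ∀ t ∈ Set.Icc (0 : ℝ) L, 0 < 1 - η * F t := by
    intro hp
    have hg : ∀ t, HasDerivAt (fun t => z t * z1 t) (z1 t * z1 t + z t * z2 t) t :=
      fun t => (h1 t).mul (h2 t)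
    have hmono : MonotoneOn (fun t => z t * z1 t) (Set.Icc 0 L) := by
      apply monotoneOn_of_deriv_nonneg (convex_Icc 0 L)
      · exact fun x _ => (hg x).continuousAt.continuousWithinAt
      · exact fun x _ => (hg x).differentiableAt.differentiableWithinAt
      · intro x hx
        rw [(hg x).deriv, heq' x (interior_subset hx)]
        have := hp x (interior_subset hx)
        nlinarith [mul_nonneg this.le (sq_nonneg (z x)), sq_nonneg (z1 x)]
    have hzero : ∀ t ∈ Set.Icc (0 : ℝ) L, z t * z1 t = 0 := by
      intro t ht
      have ha := hmono ⟨le_rfl, hL.le⟩ ht ht.1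
      have hb := hmono ht ⟨hL.le, le_rfl⟩ ht.2
      simp only [hbc0, hbc1, mul_zero] at ha hb
      exact le_antisymm hb ha
    have hmid : L / 2 ∈ Set.Ioo (0 : ℝ) L := ⟨by linarith, by linarith⟩
    have hmid' := Set.Ioo_subset_Icc_self hmid
    have hd : z1 (L/2) * z1 (L/2) + z (L/2) * z2 (L/2) = 0 := by
      have hd0 : HasDerivAt (fun t => z t * z1 t) 0 (L / 2) := by
        refine (hasDerivAt_const (L / 2) (0 : ℝ)).congr_of_eventuallyEq ?_
        filter_upwards [Icc_mem_nhds hmid.1 hmid.2] with t ht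
        exact hzero t ht
      exact (hg _).unique hd0
    rw [heq' _ hmid'] at hd
    have hpm := hp _ hmid'
    have hA := mul_nonneg hpm.le (sq_nonneg (z (L/2)))
    have hz0 : (1 - η * F (L/2)) * z (L/2) ^ 2 = 0 := by
      nlinarith [sq_nonneg (z1 (L/2))]
    have hz10 : z1 (L/2) ^ 2 = 0 := by nlinarith
    refine hnd _ hmid' ⟨?_, ?_⟩
    · rcases mul_eq_zero.1 hz0 with h | h
      · exact absurd h hpm.ne'
      · exact pow_eq_zero_iff two_ne_zero |>.1 h
    · exact pow_eq_zero_iff two_ne_zero |>.1 hz10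
  have hη : 0 < η := by
    by_contra h
    apply hen
    intro t ht
    have := hbounds t ht
    nlinarith [mul_nonneg (neg_nonneg.2 (not_lt.1 h)) (hm.le.trans this.1)]
  have hηM : 1 ≤ η * M := by
    by_contra h
    apply hen
    intro t ht
    have := mul_le_mul_of_nonneg_left (hbounds t ht).2 hη.le
    linarith
  -- angle
  have hang : ∀ ω : ℝ, 0 < ω → ∃ c ∈ Set.Icc (0 : ℝ) L,
      (𝔭 : ℝ) / 𝔮 * (ω ^ 2 * z c ^ 2 + z1 c ^ 2) = ω * (z1 c ^ 2 + (η * F c - 1) * z c ^ 2) ∧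
      0 < ω ^ 2 * z c ^ 2 + z1 c ^ 2 := by
    intro ω hω
    have hR : ∀ t ∈ Set.Icc (0 : ℝ) L, 0 < ω ^ 2 * z t ^ 2 + z1 t ^ 2 := by
      intro t ht
      by_cases h : z t = 0
      · have : z1 t ≠ 0 := fun h' => hnd t ht ⟨h, h'⟩
        positivity
      · positivity
    obtain ⟨θ, g, hθ, hθ0, hg, hA⟩ := aux_prufer z z1 z2 L ω hL hω h1 h2 hz2c hR hbc0
    have hiff : ∀ t ∈ Set.Icc (0 : ℝ) L, (z t = 0 ↔ cos (θ t) = 0) := by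
      intro t ht
      obtain ⟨A, hA0, hA1, hA2⟩ := hA t ht
      constructor
      · intro h
        rw [h, mul_zero] at hA1
        exact (mul_eq_zero.1 hA1.symm).resolve_left hA0
      · intro h
        rw [h, mul_zero] at hA1
        exact (mul_eq_zero.1 hA1).resolve_left hω.ne'
    have hset : {t ∈ Set.Ioo (0 : ℝ) L | z t = 0} = {t ∈ Set.Ioo (0 : ℝ) L | cos (θ t) = 0} := by
      ext t
      constructor
      · rintro ⟨ha, hb⟩
        exact ⟨ha, (hiff t (Set.Ioo_subset_Icc_self ha)).1 hb⟩
      · rintro ⟨ha, hb⟩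
        exact ⟨ha, (hiff t (Set.Ioo_subset_Icc_self ha)).2 hb⟩
    have hcount := aux_count θ g L hL hθ hθ0 (by
      intro t ht h
      have hz0 := (hiff t ht).2 h
      have hRt := hR t ht
      rw [hg t ht]
      rw [hz0] at hRt ⊢
      have h3 : 0 < z1 t ^ 2 := by simpa using hRt
      simp only [zero_mul, sub_zero]
      positivity) (by
      obtain ⟨A, hA0, hA1, hA2⟩ := hA L ⟨hL.le, le_rfl⟩
      rw [hbc1] at hA2
      exact (mul_eq_zero.1 hA2.symm).resolve_left (neg_ne_zero.2 hA0))
    rw [← hset, hzeros.2] at hcount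
    obtain ⟨c, hc, hce⟩ := exists_hasDerivAt_eq_slope θ g hL
      (fun x _ => (hθ x).continuousAt.continuousWithinAt) (fun x _ => hθ x)
    have hc' := Set.Ioo_subset_Icc_self hc
    refine ⟨c, hc', ?_, hR c hc'⟩
    have hslope : (θ L - θ 0) / (L - 0) = (𝔭 : ℝ) / 𝔮 := by
      rw [hcount, hθ0, hLdef]
      field_simp
      ring
    rw [hslope, hg c hc'] at hce
    rw [← hce, div_mul_cancel₀ _ (hR c hc').ne', heq' c hc']
    ring
  constructor
  · rw [div_le_iff₀ hM]
    by_contra hcon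
    have hcon' : η * M - 1 < ((𝔭 : ℝ) / 𝔮) ^ 2 := by linarith
    have hpq : (0 : ℝ) ≤ (𝔭 : ℝ) / 𝔮 := by positivity
    obtain ⟨ω, hω1, hω2⟩ := exists_between
      ((Real.sqrt_lt' (lt_of_le_of_ne hpq (by
        intro h
        rw [← h] at hcon'
        linarith))).2 hcon')
    have hω0 : 0 < ω := (Real.sqrt_nonneg _).trans_lt hω1
    have hω3 : η * M - 1 ≤ ω ^ 2 := ((Real.sqrt_lt' hω0).1 hω1).le
    obtain ⟨c, hc, hce, hR⟩ := hang ω hω0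
    have hF' := mul_le_mul_of_nonneg_left (hbounds c hc).2 hη.le
    have h3 : (η * F c - 1) * z c ^ 2 ≤ ω ^ 2 * z c ^ 2 :=
      mul_le_mul_of_nonneg_right (by linarith) (sq_nonneg _)
    have h4 := mul_lt_mul_of_pos_right hω2 hR
    have h5 := mul_le_mul_of_nonneg_left h3 hω0.le
    nlinarith
  · rw [le_div_iff₀ hm]
    by_contra hcon
    have hcon' : ((𝔭 : ℝ) / 𝔮) ^ 2 < η * m - 1 := by linarith
    have hpq : (0 : ℝ) ≤ (𝔭 : ℝ) / 𝔮 := by positivity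
    have hω2 := (Real.lt_sqrt hpq).2 hcon'
    have hω0 := hpq.trans_lt hω2
    have hω3 := Real.sq_sqrt (show 0 ≤ η * m - 1 by nlinarith [sq_nonneg ((𝔭 : ℝ) / 𝔮)])
    obtain ⟨c, hc, hce, hR⟩ := hang _ hω0
    have hF' := mul_le_mul_of_nonneg_left (hbounds c hc).1 hη.le
    have h3 : √(η * m - 1) ^ 2 * z c ^ 2 ≤ (η * F c - 1) * z c ^ 2 :=
      mul_le_mul_of_nonneg_right (by linarith) (sq_nonneg _)
    have h4 := mul_lt_mul_of_pos_right hω2 hR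
    have h5 := mul_le_mul_of_nonneg_left h3 hω0.le
    nlinarith
end

section
/- Let 𝔮 be a positive integer, 𝔭 a nonnegative integer, and G : [0, π𝔮] → ℝ a continuous function with 0 < b ≤ G(t) ≤ a for all t. If z : [0, π𝔮] → ℝ is a C² function, not identically zero, satisfying z̈(t) = −G(t) z(t) on [0, π𝔮] with ż(0) = ż(π𝔮) = 0 and having exactly 𝔭 zeros in the open interval (0, π𝔮), then b ≤ (𝔭/𝔮)² ≤ a. Equivalently, if (𝔭/𝔮)² ∉ [b, a], no such solution exists (so the 𝔭-th eigenvalue of the associated Sturm–Liouville problem cannot equal 1). -/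
open Real

/-- Uniqueness for the Cauchy problem, in energy form. -/
lemma energy_pos (L : ℝ) (G : ℝ → ℝ) (a : ℝ)
    (hbounds : ∀ t ∈ Set.Icc (0 : ℝ) L, 0 < G t ∧ G t ≤ a)
    (z : ℝ → ℝ) (hz1 : ∀ t, HasDerivAt z (deriv z t) t)
    (hz2 : ∀ t, HasDerivAt (deriv z) (deriv (deriv z) t) t)
    (hnz : ¬ ∀ t ∈ Set.Icc (0 : ℝ) L, z t = 0)
    (heq : ∀ t ∈ Set.Icc (0 : ℝ) L, deriv (deriv z) t = -(G t * z t)) :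
    ∀ t ∈ Set.Icc (0 : ℝ) L, 0 < z t ^ 2 + deriv z t ^ 2 := by
  intro t₀ ht₀
  by_contra hcon
  have h0 : z t₀ ^ 2 + deriv z t₀ ^ 2 = 0 := le_antisymm (not_lt.mp hcon) (by positivity)
  apply hnz
  have hE : ∀ K t, HasDerivAt (fun t => (z t ^ 2 + deriv z t ^ 2) * exp (K * t))
      ((2 * z t * deriv z t + 2 * deriv z t * deriv (deriv z) t) * exp (K * t)
        + (z t ^ 2 + deriv z t ^ 2) * (exp (K * t) * K)) t := by
    intro K t
    have h1 := ((hz1 t).pow 2).add ((hz2 t).pow 2)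
    have h2 : HasDerivAt (fun t => exp (K * t)) (exp (K * t) * K) t := by
      simpa using ((hasDerivAt_id t).const_mul K).exp
    refine (h1.mul h2).congr_deriv ?_
    simp
  have hcont : ∀ K, Continuous (fun t => (z t ^ 2 + deriv z t ^ 2) * exp (K * t)) :=
    fun K => continuous_iff_continuousAt.mpr fun t => (hE K t).continuousAt
  have hmono : MonotoneOn (fun t => (z t ^ 2 + deriv z t ^ 2) * exp ((1 + a) * t))
      (Set.Icc 0 L) := by
    apply monotoneOn_of_deriv_nonneg (convex_Icc _ _) (hcont _).continuousOn
      (fun t _ => (hE _ t).differentiableAt.differentiableWithinAt)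
    intro t ht
    have ht' := interior_subset ht
    rw [(hE _ t).deriv, heq t ht']
    obtain ⟨g1, g2⟩ := hbounds t ht'
    have : 0 ≤ 2 * z t * deriv z t + 2 * deriv z t * (-(G t * z t))
        + (1 + a) * (z t ^ 2 + deriv z t ^ 2) := by
      nlinarith [sq_nonneg (z t + deriv z t), mul_nonneg g1.le (sq_nonneg (z t - deriv z t)),
        mul_nonneg (sub_nonneg.mpr g2) (add_nonneg (sq_nonneg (z t)) (sq_nonneg (deriv z t)))]
    have := mul_nonneg this (exp_pos ((1 + a) * t)).le
    linarith
  have hanti : AntitoneOn (fun t => (z t ^ 2 + deriv z t ^ 2) * exp (-(1 + a) * t))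
      (Set.Icc 0 L) := by
    apply antitoneOn_of_deriv_nonpos (convex_Icc _ _) (hcont _).continuousOn
      (fun t _ => (hE _ t).differentiableAt.differentiableWithinAt)
    intro t ht
    have ht' := interior_subset ht
    rw [(hE _ t).deriv, heq t ht']
    obtain ⟨g1, g2⟩ := hbounds t ht'
    have : 0 ≤ -(2 * z t * deriv z t + 2 * deriv z t * (-(G t * z t)))
        + (1 + a) * (z t ^ 2 + deriv z t ^ 2) := by
      nlinarith [sq_nonneg (z t - deriv z t), mul_nonneg g1.le (sq_nonneg (z t + deriv z t)),
        mul_nonneg (sub_nonneg.mpr g2) (add_nonneg (sq_nonneg (z t)) (sq_nonneg (deriv z t)))]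
    have := mul_nonneg this (exp_pos (-(1 + a) * t)).le
    linarith
  intro t ht
  have key : z t ^ 2 + deriv z t ^ 2 ≤ 0 := by
    rcases le_total t t₀ with h | h
    · have := hmono ht ht₀ h
      simp only [h0, zero_mul] at this
      exact nonpos_of_mul_nonpos_left this (exp_pos _)
    · have := hanti ht₀ ht h
      simp only [h0, zero_mul] at this
      exact nonpos_of_mul_nonpos_left this (exp_pos _)
  have : z t ^ 2 = 0 := by nlinarith [sq_nonneg (z t), sq_nonneg (deriv z t)]
  exact pow_eq_zero_iff (two_ne_zero) |>.mp this

/-- Counting lemma for the Prüfer angle. -/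
lemma count_angle (L : ℝ) (hL : 0 < L) (θ : ℝ → ℝ) (hc : Continuous θ) (hm : StrictMono θ)
    (h0 : θ 0 = 0) (hs : sin (θ L) = 0) :
    θ L = ({t ∈ Set.Ioo (0 : ℝ) L | cos (θ t) = 0}.ncard : ℝ) * π := by
  obtain ⟨k, hk⟩ := sin_eq_zero_iff.mp hs
  have hpos : 0 < θ L := h0 ▸ hm hL
  have hk0 : 0 < k := by
    rw [← hk] at hpos
    exact_mod_cast (pos_of_mul_pos_left hpos pi_pos.le)
  lift k to ℕ using hk0.le
  have hkk : (k : ℝ) * π = θ L := by exact_mod_cast hk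
  have himg : θ '' {t ∈ Set.Ioo (0 : ℝ) L | cos (θ t) = 0}
      = (fun j : ℕ => (2 * (j : ℝ) + 1) * π / 2) '' (Finset.range k : Set ℕ) := by
    ext y
    constructor
    · rintro ⟨t, ⟨⟨ht0, htL⟩, hcos⟩, rfl⟩
      obtain ⟨j, hj⟩ := cos_eq_zero_iff.mp hcos
      have hp1 : 0 < θ t := h0 ▸ hm ht0
      have hp2 : θ t < k * π := hkk ▸ hm htL
      rw [hj] at hp1 hp2
      have q1 : (0 : ℝ) < 2 * j + 1 := by
        by_contra h
        nlinarith [pi_pos]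
      have q2 : (2 * j + 1 : ℝ) < 2 * k := by
        by_contra h
        nlinarith [pi_pos]
      have q1' : (0 : ℤ) < 2 * j + 1 := by exact_mod_cast q1
      have q2' : (2 * j + 1 : ℤ) < 2 * k := by exact_mod_cast q2
      lift j to ℕ using (by omega)
      refine ⟨j, ?_, ?_⟩
      · simp only [Finset.coe_range, Set.mem_Iio]; omega
      · simp [hj]
    · rintro ⟨j, hj, rfl⟩
      have hj' : j < k := by simpa using hj
      have hj'' : (j : ℝ) + 1 ≤ k := by exact_mod_cast hj'
      have hmem : (2 * (j : ℝ) + 1) * π / 2 ∈ Set.Ioo (θ 0) (θ L) := by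
        rw [h0, ← hkk]
        constructor
        · positivity
        · nlinarith [pi_pos]
      obtain ⟨t, ht, hte⟩ := intermediate_value_Ioo hL.le hc.continuousOn hmem
      refine ⟨t, ⟨ht, ?_⟩, hte⟩
      rw [hte, cos_eq_zero_iff]
      exact ⟨j, by simp⟩
  have hn : {t ∈ Set.Ioo (0 : ℝ) L | cos (θ t) = 0}.ncard = k := by
    rw [← Set.ncard_image_of_injective _ hm.injective, himg, Set.ncard_image_of_injective]
    · rw [Set.ncard_coe_finset]; simp
    · intro i j hij
      have := pi_pos
      simp only at hij
      have h2 : (i : ℝ) * π = j * π := by linarith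
      exact_mod_cast mul_right_cancel₀ this.ne' h2
  rw [hn, hkk]

/-- The Prüfer angle at frequency `ω`. -/
lemma prufer (L : ℝ) (hL : 0 < L) (G : ℝ → ℝ) (a : ℝ)
    (hbounds : ∀ t ∈ Set.Icc (0 : ℝ) L, 0 < G t ∧ G t ≤ a)
    (z : ℝ → ℝ) (hz1 : ∀ t, HasDerivAt z (deriv z t) t)
    (hz2 : ∀ t, HasDerivAt (deriv z) (deriv (deriv z) t) t)
    (hz3 : Continuous (deriv (deriv z)))
    (hnz : ¬ ∀ t ∈ Set.Icc (0 : ℝ) L, z t = 0)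
    (heq : ∀ t ∈ Set.Icc (0 : ℝ) L, deriv (deriv z) t = -(G t * z t))
    (hbc0 : deriv z 0 = 0) (hbc1 : deriv z L = 0) (ω : ℝ) (hω : 0 < ω) :
    ((∀ t ∈ Set.Icc (0 : ℝ) L, ω ^ 2 ≤ G t) →
      ω * L ≤ ({t ∈ Set.Ioo (0 : ℝ) L | z t = 0}.ncard : ℝ) * π) ∧
    ((∀ t ∈ Set.Icc (0 : ℝ) L, G t ≤ ω ^ 2) →
      ({t ∈ Set.Ioo (0 : ℝ) L | z t = 0}.ncard : ℝ) * π ≤ ω * L) := by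
  have hE := energy_pos L G a hbounds z hz1 hz2 hnz heq
  have hD : ∀ t ∈ Set.Icc (0 : ℝ) L, 0 < ω ^ 2 * z t ^ 2 + deriv z t ^ 2 := by
    intro t ht
    by_contra hcon
    have h1 : 0 ≤ ω ^ 2 * z t ^ 2 := by positivity
    have h2 := sq_nonneg (deriv z t)
    have h3 : ω ^ 2 * z t ^ 2 = 0 := by linarith
    have h4 : z t ^ 2 = 0 := by
      rcases mul_eq_zero.mp h3 with h | h
      · exact absurd h (by positivity)
      · exact h
    have := hE t ht
    linarith
  have hzc : Continuous z := continuous_iff_continuousAt.mpr fun t => (hz1 t).continuousAt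
  have hzc' : Continuous (deriv z) := continuous_iff_continuousAt.mpr fun t => (hz2 t).continuousAt
  set F : ℝ → ℝ := fun t => ω * (deriv z t ^ 2 - z t * deriv (deriv z) t) /
    (ω ^ 2 * z t ^ 2 + deriv z t ^ 2) with hF
  have hFc : ContinuousOn F (Set.Icc 0 L) := by
    apply ContinuousOn.div
    · fun_prop
    · fun_prop
    · intro t ht; exact (hD t ht).ne'
  set f : ℝ → ℝ := fun t => F (Set.projIcc 0 L hL.le t) with hf
  have hfc : Continuous f := by
    have := continuousOn_iff_continuous_domRestrict.mp hFc
    exact this.comp continuous_projIcc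
  have hfF : ∀ t ∈ Set.Icc (0 : ℝ) L, f t = F t := by
    intro t ht
    simp [hf, Set.projIcc_of_mem hL.le ht]
  have hFpos : ∀ t ∈ Set.Icc (0 : ℝ) L, 0 < F t := by
    intro t ht
    apply div_pos _ (hD t ht)
    rw [heq t ht]
    have g := (hbounds t ht).1
    have hE' := hE t ht
    apply mul_pos hω
    rcases eq_or_ne (z t) 0 with h | h
    · rw [h] at hE' ⊢; linarith
    · have : 0 < G t * z t ^ 2 := by positivity
      nlinarith [sq_nonneg (deriv z t)]
  have hfpos : ∀ t, 0 < f t := fun t => hFpos _ (Set.projIcc 0 L hL.le t).2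
  set θ : ℝ → ℝ := fun t => ∫ s in (0 : ℝ)..t, f s with hθ
  have hθd : ∀ t, HasDerivAt θ (f t) t := fun t => hfc.integral_hasStrictDerivAt 0 t |>.hasDerivAt
  have hθ0 : θ 0 = 0 := by simp [hθ]
  have hθc : Continuous θ := continuous_iff_continuousAt.mpr fun t => (hθd t).continuousAt
  have hθm : StrictMono θ := strictMono_of_deriv_pos fun t => by rw [(hθd t).deriv]; exact hfpos t
  -- the angle relation
  set A : ℝ → ℝ := fun t => ω * z t * sin (θ t) + deriv z t * cos (θ t) with hA
  have hAd : ∀ t, HasDerivAt A (ω * deriv z t * sin (θ t) + ω * z t * (cos (θ t) * f t)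
      + (deriv (deriv z) t * cos (θ t) + deriv z t * (-sin (θ t) * f t))) t := by
    intro t
    exact (((hz1 t).const_mul ω).mul (hθd t).sin).add ((hz2 t).mul (hθd t).cos)
  have hDd : ∀ t, HasDerivAt (fun t => ω ^ 2 * z t ^ 2 + deriv z t ^ 2)
      (ω ^ 2 * (2 * z t * deriv z t) + 2 * deriv z t * deriv (deriv z) t) t := by
    intro t
    refine ((((hz1 t).pow 2).const_mul (ω ^ 2)).add ((hz2 t).pow 2)).congr_deriv ?_
    simp
  have hQd : ∀ t ∈ Set.Icc (0 : ℝ) L,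
      HasDerivAt (fun t => A t ^ 2 / (ω ^ 2 * z t ^ 2 + deriv z t ^ 2)) 0 t := by
    intro t ht
    have hd := (hD t ht).ne'
    have := ((hAd t).pow 2).div (hDd t) hd
    refine this.congr_deriv ?_
    rw [div_eq_zero_iff]
    left
    have hfD : f t * (ω ^ 2 * z t ^ 2 + deriv z t ^ 2)
        = ω * (deriv z t ^ 2 - z t * deriv (deriv z) t) := by
      rw [hfF t ht, hF]; field_simp
    simp only [hA, Pi.pow_apply]
    push_cast
    linear_combination 2 * (ω * z t * sin (θ t) + deriv z t * cos (θ t)) *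
      (ω * z t * cos (θ t) - deriv z t * sin (θ t)) * hfD
  have hQ := constant_of_has_deriv_right_zero (a := 0) (b := L)
    (fun t ht => (hQd t ht).continuousAt.continuousWithinAt)
    (fun t ht => (hQd t ⟨ht.1, ht.2.le⟩).hasDerivWithinAt)
  have hA0 : ∀ t ∈ Set.Icc (0 : ℝ) L, ω * z t * sin (θ t) + deriv z t * cos (θ t) = 0 := by
    intro t ht
    have h := hQ t ht
    have hz : A 0 = 0 := by simp [hA, hθ0, hbc0]
    simp only [hz] at h
    have h' : A t ^ 2 / (ω ^ 2 * z t ^ 2 + deriv z t ^ 2) = 0 := by rw [h]; simp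
    rcases div_eq_zero_iff.mp h' with h' | h'
    · exact pow_eq_zero_iff (two_ne_zero) |>.mp h'
    · exact absurd h' (hD t ht).ne'
  have hset : {t ∈ Set.Ioo (0 : ℝ) L | z t = 0} = {t ∈ Set.Ioo (0 : ℝ) L | cos (θ t) = 0} := by
    ext t
    simp only [Set.mem_setOf_eq, and_congr_right_iff]
    intro ht
    have ht' : t ∈ Set.Icc (0 : ℝ) L := ⟨ht.1.le, ht.2.le⟩
    have h1 := hA0 t ht'
    constructor
    · intro h
      have h2 := hE t ht'
      rw [h] at h1 h2
      have h3 : deriv z t ≠ 0 := by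
        intro h3; rw [h3] at h2; simp at h2
      have h4 : deriv z t * cos (θ t) = 0 := by linarith
      exact (mul_eq_zero.mp h4).resolve_left h3
    · intro h
      have h2 := sin_sq_add_cos_sq (θ t)
      rw [h] at h1 h2
      have h3 : sin (θ t) ≠ 0 := by
        intro h3; rw [h3] at h2; simp at h2
      have h4 : ω * z t * sin (θ t) = 0 := by linarith
      exact (mul_eq_zero.mp ((mul_eq_zero.mp h4).resolve_right h3)).resolve_left hω.ne'
  have hLm : L ∈ Set.Icc (0 : ℝ) L := ⟨hL.le, le_rfl⟩
  have hsin : sin (θ L) = 0 := by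
    have h1 := hA0 L hLm
    have h2 := hE L hLm
    rw [hbc1] at h1 h2
    have h3 : z L ≠ 0 := by
      intro h3; rw [h3] at h2; simp at h2
    have h4 : (ω * z L) * sin (θ L) = 0 := by linarith
    exact (mul_eq_zero.mp h4).resolve_left (mul_ne_zero hω.ne' h3)
  have hcount := count_angle L hL θ hθc hθm hθ0 hsin
  rw [hset, ← hcount]
  have hsub : ∀ t, HasDerivAt (fun t => θ t - ω * t) (f t - ω) t := by
    intro t
    refine ((hθd t).sub ((hasDerivAt_id t).const_mul ω)).congr_deriv ?_
    simp
  constructor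
  · intro hg
    have hm : Monotone (fun t => θ t - ω * t) := by
      apply monotone_of_deriv_nonneg (fun t => (hsub t).differentiableAt)
      intro t
      rw [(hsub t).deriv, sub_nonneg]
      have hs := (Set.projIcc 0 L hL.le t).2
      show ω ≤ F _
      simp only [hF]
      rw [le_div_iff₀ (hD _ hs), heq _ hs]
      apply mul_le_mul_of_nonneg_left _ hω.le
      nlinarith [mul_nonneg (sub_nonneg.mpr (hg _ hs)) (sq_nonneg (z (Set.projIcc 0 L hL.le t)))]
    have := hm hL.le
    simp only [hθ0] at this
    linarith
  · intro hg
    have hm : Antitone (fun t => θ t - ω * t) := by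
      apply antitone_of_deriv_nonpos (fun t => (hsub t).differentiableAt)
      intro t
      rw [(hsub t).deriv, sub_nonpos]
      have hs := (Set.projIcc 0 L hL.le t).2
      show F _ ≤ ω
      simp only [hF]
      rw [div_le_iff₀ (hD _ hs), heq _ hs]
      apply mul_le_mul_of_nonneg_left _ hω.le
      nlinarith [mul_nonneg (sub_nonneg.mpr (hg _ hs)) (sq_nonneg (z (Set.projIcc 0 L hL.le t)))]
    have := hm hL.le
    simp only [hθ0] at this
    linarith


/-- Branch exclusion: if a nontrivial `C²` function solves
`z̈ = -G(t)z` on `[0, π𝔮]` with Neumann conditions and has exactly `𝔭` zeros in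
`(0, π𝔮)`, where `0 < b ≤ G ≤ a`, then `b ≤ (𝔭/𝔮)² ≤ a`. -/
theorem branch_exclusion
    (𝔮 : ℕ) (h𝔮 : 0 < 𝔮) (𝔭 : ℕ)
    (G : ℝ → ℝ) (hG : ContinuousOn G (Set.Icc (0 : ℝ) (π * 𝔮)))
    (b a : ℝ) (hb : 0 < b)
    (hbounds : ∀ t ∈ Set.Icc (0 : ℝ) (π * 𝔮), b ≤ G t ∧ G t ≤ a)
    (z : ℝ → ℝ) (hz : ContDiff ℝ 2 z)
    (hnz : ¬ ∀ t ∈ Set.Icc (0 : ℝ) (π * 𝔮), z t = 0)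
    (heq : ∀ t ∈ Set.Icc (0 : ℝ) (π * 𝔮), deriv (deriv z) t = -(G t * z t))
    (hbc0 : deriv z 0 = 0) (hbc1 : deriv z (π * 𝔮) = 0)
    (hzeros : {t ∈ Set.Ioo (0 : ℝ) (π * 𝔮) | z t = 0}.Finite ∧
      {t ∈ Set.Ioo (0 : ℝ) (π * 𝔮) | z t = 0}.ncard = 𝔭) :
    b ≤ ((𝔭 : ℝ) / 𝔮) ^ 2 ∧ ((𝔭 : ℝ) / 𝔮) ^ 2 ≤ a := by
  have hq : (0 : ℝ) < 𝔮 := by exact_mod_cast h𝔮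
  have hL : 0 < π * 𝔮 := mul_pos pi_pos hq
  have ha : 0 < a := by
    have := hbounds 0 ⟨le_rfl, hL.le⟩
    linarith
  have hz1 : ∀ t, HasDerivAt z (deriv z t) t := fun t =>
    (hz.differentiable (by norm_num) t).hasDerivAt
  have hz' : ContDiff ℝ 1 (deriv z) := by
    have : ContDiff ℝ (1 + 1) z := by norm_num; exact hz
    exact (contDiff_succ_iff_deriv.mp this).2.2
  have hz2 : ∀ t, HasDerivAt (deriv z) (deriv (deriv z) t) t := fun t =>
    (hz'.differentiable (by norm_num) t).hasDerivAt
  have hz3 : Continuous (deriv (deriv z)) := hz'.continuous_deriv (by norm_num)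
  have key := prufer (π * 𝔮) hL G a
    (fun t ht => ⟨hb.trans_le (hbounds t ht).1, (hbounds t ht).2⟩)
    z hz1 hz2 hz3 hnz heq hbc0 hbc1
  rw [hzeros.2] at key
  have k1 := (key (√b) (sqrt_pos.mpr hb)).1
    (fun t ht => by rw [sq_sqrt hb.le]; exact (hbounds t ht).1)
  have k2 := (key (√a) (sqrt_pos.mpr ha)).2
    (fun t ht => by rw [sq_sqrt ha.le]; exact (hbounds t ht).2)
  have e1 : √b * 𝔮 ≤ 𝔭 := by
    by_contra h
    nlinarith [pi_pos]
  have e2 : (𝔭 : ℝ) ≤ √a * 𝔮 := by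
    by_contra h
    nlinarith [pi_pos]
  have f1 : √b ≤ (𝔭 : ℝ) / 𝔮 := (le_div_iff₀ hq).mpr e1
  have f2 : (𝔭 : ℝ) / 𝔮 ≤ √a := (div_le_iff₀ hq).mpr e2
  constructor
  · calc b = √b ^ 2 := (sq_sqrt hb.le).symm
      _ ≤ _ := by gcongr
  · calc _ ≤ √a ^ 2 := by gcongr
      _ = a := sq_sqrt ha.le
end

section
/- The period function T : (E_min, 0) → ℝ is well-defined (the improper integral defining T(E) converges for every E ∈ (E_min, 0)), continuous, and strictly increasing. -/
open Real MeasureTheory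

/-- The kernel `H(x,s)` with `U₀ x - U₀ (x s) = x² (1 - s²) H(x,s)`. -/
noncomputable def sitH {n : ℕ} (m b : Fin n → ℝ) (x s : ℝ) : ℝ :=
  ∑ j, m j / (√((x * s) ^ 2 + b j ^ 2) * √(x ^ 2 + b j ^ 2) *
    (√((x * s) ^ 2 + b j ^ 2) + √(x ^ 2 + b j ^ 2)))

lemma sitH_cont {n : ℕ} (m b : Fin n → ℝ) (hb : ∀ j, 0 < b j) :
    Continuous (fun p : ℝ × ℝ => sitH m b p.1 p.2) := by
  unfold sitH
  refine continuous_finsetSum _ fun j _ => ?_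
  refine Continuous.div (by fun_prop) (by fun_prop) fun p => ?_
  have := hb j
  positivity

lemma sitH_pos {n : ℕ} (hn : 1 ≤ n) (m b : Fin n → ℝ) (hm : ∀ j, 0 < m j) (hb : ∀ j, 0 < b j)
    (x s : ℝ) : 0 < sitH m b x s := by
  unfold sitH
  refine Finset.sum_pos (fun j _ => ?_) ⟨⟨0, hn⟩, Finset.mem_univ _⟩
  have := hb j
  have := hm j
  positivity

lemma sitH_lt {n : ℕ} (hn : 1 ≤ n) (m b : Fin n → ℝ) (hm : ∀ j, 0 < m j) (hb : ∀ j, 0 < b j)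
    {x y : ℝ} (s : ℝ) (hx : 0 ≤ x) (hxy : x < y) : sitH m b y s < sitH m b x s := by
  unfold sitH
  refine Finset.sum_lt_sum_of_nonempty ⟨⟨0, hn⟩, Finset.mem_univ _⟩ (fun j _ => ?_)
  have hbj := hb j
  have hmj := hm j
  have h1 : x ^ 2 < y ^ 2 := by nlinarith
  have h2 : (x * s) ^ 2 ≤ (y * s) ^ 2 := by
    rw [mul_pow, mul_pow]; gcongr
  have h3 : √(x ^ 2 + b j ^ 2) < √(y ^ 2 + b j ^ 2) :=
    Real.sqrt_lt_sqrt (by positivity) (by linarith)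
  have h4 : √((x * s) ^ 2 + b j ^ 2) ≤ √((y * s) ^ 2 + b j ^ 2) :=
    Real.sqrt_le_sqrt (by linarith)
  have p1 : 0 < √(x ^ 2 + b j ^ 2) := by positivity
  have p2 : 0 < √((x * s) ^ 2 + b j ^ 2) := by positivity
  refine div_lt_div_of_pos_left hmj (by positivity) ?_
  have h5 : √((x * s) ^ 2 + b j ^ 2) * √(x ^ 2 + b j ^ 2) ≤
    √((y * s) ^ 2 + b j ^ 2) * √(y ^ 2 + b j ^ 2) := by gcongr
  exact mul_lt_mul_of_le_of_lt_of_pos_of_nonneg h5 (by linarith) (by positivity) (by positivity)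

lemma sit_diff {n : ℕ} (m b : Fin n → ℝ) (hb : ∀ j, 0 < b j) (x s : ℝ) :
    (-∑ j, m j / √(x ^ 2 + b j ^ 2)) - (-∑ j, m j / √((x * s) ^ 2 + b j ^ 2))
      = x ^ 2 * ((1 - s) * ((1 + s) * sitH m b x s)) := by
  unfold sitH
  rw [neg_sub_neg, ← Finset.sum_sub_distrib, Finset.mul_sum, Finset.mul_sum, Finset.mul_sum]
  refine Finset.sum_congr rfl fun j _ => ?_
  have hbj := hb j
  have p1 : 0 < √(x ^ 2 + b j ^ 2) := by positivity
  have p2 : 0 < √((x * s) ^ 2 + b j ^ 2) := by positivity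
  have q1 : √(x ^ 2 + b j ^ 2) ^ 2 = x ^ 2 + b j ^ 2 := Real.sq_sqrt (by positivity)
  have q2 : √((x * s) ^ 2 + b j ^ 2) ^ 2 = (x * s) ^ 2 + b j ^ 2 := Real.sq_sqrt (by positivity)
  generalize √(x ^ 2 + b j ^ 2) = a at *
  generalize √((x * s) ^ 2 + b j ^ 2) = c at *
  field_simp
  linear_combination m j * (q1 - q2)

/-- The rescaled, regular factor of the integrand. -/
noncomputable def sitK {n : ℕ} (m b : Fin n → ℝ) (x s : ℝ) : ℝ :=
  ((1 + s) * sitH m b x s) ^ (-(1 / 2) : ℝ)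

lemma sit_w : IntervalIntegrable (fun s : ℝ => (1 - s) ^ (-(1 / 2) : ℝ)) volume 0 1 := by
  have h := (intervalIntegral.intervalIntegrable_rpow' (a := 0) (b := 1) (r := (-(1 / 2) : ℝ))
    (by norm_num)).comp_sub_left 1
  simpa using h.symm

lemma sitK_contOn {n : ℕ} (hn : 1 ≤ n) (m b : Fin n → ℝ) (hm : ∀ j, 0 < m j)
    (hb : ∀ j, 0 < b j) (x : ℝ) : ContinuousOn (sitK m b x) (Set.uIcc 0 1) := by
  unfold sitK
  have hc : Continuous fun s => sitH m b x s :=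
    Continuous.comp (g := fun p : ℝ × ℝ => sitH m b p.1 p.2) (f := fun s => (x, s))
      (sitH_cont m b hb) (by fun_prop)
  refine ContinuousOn.rpow_const (by fun_prop) fun s hs => Or.inl ?_
  rw [Set.uIcc_of_le zero_le_one] at hs
  have := sitH_pos hn m b hm hb x s
  have := hs.1
  positivity

lemma sitK_int {n : ℕ} (hn : 1 ≤ n) (m b : Fin n → ℝ) (hm : ∀ j, 0 < m j)
    (hb : ∀ j, 0 < b j) (x : ℝ) :
    IntervalIntegrable (fun s : ℝ => (1 - s) ^ (-(1 / 2) : ℝ) * sitK m b x s) volume 0 1 :=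
  sit_w.mul_continuousOn (sitK_contOn hn m b hm hb x)

lemma sitK_lt {n : ℕ} (hn : 1 ≤ n) (m b : Fin n → ℝ) (hm : ∀ j, 0 < m j)
    (hb : ∀ j, 0 < b j) {x y s : ℝ} (hs : 0 ≤ s) (hx : 0 ≤ x) (hxy : x < y) :
    sitK m b x s < sitK m b y s := by
  unfold sitK
  have h1 := sitH_pos hn m b hm hb y s
  have h2 := sitH_lt hn m b hm hb s hx hxy
  refine Real.rpow_lt_rpow_of_neg (by positivity) ?_ (by norm_num)
  gcongr

/-- The rescaled period integral. -/
noncomputable def sitF {n : ℕ} (m b : Fin n → ℝ) (x : ℝ) : ℝ :=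
  ∫ s in (0 : ℝ)..1, (1 - s) ^ (-(1 / 2) : ℝ) * sitK m b x s

lemma sitF_lt {n : ℕ} (hn : 1 ≤ n) (m b : Fin n → ℝ) (hm : ∀ j, 0 < m j)
    (hb : ∀ j, 0 < b j) {x y : ℝ} (hx : 0 ≤ x) (hxy : x < y) : sitF m b x < sitF m b y := by
  unfold sitF
  rw [← sub_pos, ← intervalIntegral.integral_sub (sitK_int hn m b hm hb y)
    (sitK_int hn m b hm hb x)]
  refine intervalIntegral.intervalIntegral_pos_of_pos_on
    ((sitK_int hn m b hm hb y).sub (sitK_int hn m b hm hb x)) (fun s hs => ?_) zero_lt_one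
  have h := sitK_lt hn m b hm hb hs.1.le hx hxy
  have h1 : 0 < 1 - s := by linarith [hs.2]
  have h2 : 0 < (1 - s) ^ (-(1 / 2) : ℝ) := Real.rpow_pos_of_pos h1 _
  nlinarith

lemma sitF_cont {n : ℕ} (hn : 1 ≤ n) (m b : Fin n → ℝ) (hm : ∀ j, 0 < m j)
    (hb : ∀ j, 0 < b j) {x : ℝ} (hx : 0 < x) : ContinuousAt (sitF m b) x := by
  unfold sitF
  refine intervalIntegral.continuousAt_of_dominated_interval
    (bound := fun s => (1 - s) ^ (-(1 / 2) : ℝ) * sitK m b (x + 1) s) ?_ ?_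
    (sitK_int hn m b hm hb _) ?_
  · exact Filter.Eventually.of_forall fun y =>
      (intervalIntegrable_iff.1 (sitK_int hn m b hm hb y)).aestronglyMeasurable
  · filter_upwards [Ioo_mem_nhds hx (lt_add_one x)] with y hy
    refine Filter.Eventually.of_forall fun s hs => ?_
    rw [Set.uIoc_of_le zero_le_one] at hs
    have h1 : 0 ≤ 1 - s := by linarith [hs.2]
    have h2 : 0 ≤ (1 - s) ^ (-(1 / 2) : ℝ) := Real.rpow_nonneg h1 _
    have h3 := sitK_lt hn m b hm hb hs.1.le hy.1.le hy.2
    have h4 : 0 ≤ sitK m b y s := by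
      unfold sitK
      have := sitH_pos hn m b hm hb y s
      have := hs.1
      positivity
    rw [Real.norm_of_nonneg (mul_nonneg h2 h4)]
    gcongr
  · refine Filter.Eventually.of_forall fun s hs => ?_
    rw [Set.uIoc_of_le zero_le_one] at hs
    refine continuousAt_const.mul ?_
    unfold sitK
    have hc : Continuous fun y => sitH m b y s :=
      Continuous.comp (g := fun p : ℝ × ℝ => sitH m b p.1 p.2) (f := fun y => (y, s))
      (sitH_cont m b hb) (by fun_prop)
    refine ContinuousAt.rpow_const (continuousAt_const.mul hc.continuousAt) (Or.inl ?_)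
    have := sitH_pos hn m b hm hb x s
    have := hs.1
    positivity

lemma sit_scale {n : ℕ} (hn : 1 ≤ n) (m b : Fin n → ℝ) (hm : ∀ j, 0 < m j)
    (hb : ∀ j, 0 < b j) (U : ℝ → ℝ) (hU : ∀ z : ℝ, U z = -∑ j, m j / √(z ^ 2 + b j ^ 2))
    {x : ℝ} (hx : 0 < x) :
    IntervalIntegrable (fun z => (U x - U z) ^ (-(1 / 2) : ℝ)) volume 0 x ∧
      ∫ z in (0 : ℝ)..x, (U x - U z) ^ (-(1 / 2) : ℝ) = sitF m b x := by
  have key : ∀ s ∈ Set.Icc (0 : ℝ) 1, (U x - U (x * s)) ^ (-(1 / 2) : ℝ)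
      = x⁻¹ * ((1 - s) ^ (-(1 / 2) : ℝ) * sitK m b x s) := by
    intro s hs
    have h0 := sitH_pos hn m b hm hb x s
    have h1 : 0 ≤ 1 - s := by linarith [hs.2]
    have h2 : 0 ≤ 1 + s := by linarith [hs.1]
    rw [hU, hU, sit_diff m b hb x s, Real.mul_rpow (by positivity) (by positivity),
      Real.mul_rpow h1 (by positivity), ← Real.rpow_natCast x 2, ← Real.rpow_mul hx.le]
    norm_num [sitK, Real.rpow_neg_one]
  constructor
  · have h1 : IntervalIntegrable (fun s => (U x - U (x * s)) ^ (-(1 / 2) : ℝ)) volume 0 1 := by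
      refine ((sitK_int hn m b hm hb x).const_mul x⁻¹).congr ?_
      intro s hs
      rw [Set.uIoc_of_le zero_le_one] at hs
      exact (key s ⟨hs.1.le, hs.2⟩).symm
    have h2 := h1.comp_mul_left (c := x⁻¹)
    have hx' := hx.ne'
    simpa [mul_inv_cancel_left₀ hx'] using h2
  · have h := intervalIntegral.integral_comp_mul_left (a := 0) (b := 1)
      (fun z => (U x - U z) ^ (-(1 / 2) : ℝ)) hx.ne'
    rw [mul_zero, mul_one, smul_eq_mul] at h
    have h' : ∫ s in (0 : ℝ)..1, (U x - U (x * s)) ^ (-(1 / 2) : ℝ) = x⁻¹ * sitF m b x := by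
      unfold sitF
      rw [← intervalIntegral.integral_const_mul]
      refine intervalIntegral.integral_congr fun s hs => ?_
      rw [Set.uIcc_of_le zero_le_one] at hs
      exact key s hs
    rw [h'] at h
    exact (mul_left_cancel₀ (inv_ne_zero hx.ne') h).symm

lemma sit_U_mono {n : ℕ} (hn : 1 ≤ n) (m b : Fin n → ℝ) (hm : ∀ j, 0 < m j)
    (hb : ∀ j, 0 < b j) (U : ℝ → ℝ) (hU : ∀ z : ℝ, U z = -∑ j, m j / √(z ^ 2 + b j ^ 2)) :
    StrictMonoOn U (Set.Ici 0) := by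
  intro x hx y hy hxy
  have hx0 : 0 ≤ x := hx
  have hy0 : 0 < y := lt_of_le_of_lt hx0 hxy
  have h := sit_diff m b hb y (x / y)
  rw [mul_div_cancel₀ x hy0.ne', ← hU, ← hU] at h
  have h1 : x / y < 1 := (div_lt_one hy0).2 hxy
  have h2 : 0 ≤ x / y := by positivity
  have h3 := sitH_pos hn m b hm hb y (x / y)
  have h4 : 0 < 1 - x / y := by linarith
  have : 0 < U y - U x := by rw [h]; positivity
  linarith

/-- The period function
`T(E) = 2√2 ∫₀^{ζ(E)} (E - U₀(z))^{-1/2} dz` of the conservative generalized Sitnikov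
problem is well-defined (the improper integral converges), continuous, and strictly
increasing on `(E_min, 0)`. -/
theorem period_function_continuous_strict_mono
    (n : ℕ) (hn : 1 ≤ n)
    (m βv : Fin n → ℝ) (hm : ∀ j, 0 < m j) (hβv : ∀ j, 0 < βv j)
    (U₀ : ℝ → ℝ)
    (hU₀ : ∀ z : ℝ, U₀ z = -∑ j, m j / Real.sqrt (z ^ 2 + βv j ^ 2))
    (Emin : ℝ) (hEmin : Emin = U₀ 0)
    (ζ : ℝ → ℝ)
    (hζ : ∀ E ∈ Set.Ioo Emin (0 : ℝ), 0 < ζ E ∧ U₀ (ζ E) = E)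
    (T : ℝ → ℝ)
    (hT : ∀ E ∈ Set.Ioo Emin (0 : ℝ),
      T E = 2 * Real.sqrt 2 * ∫ z in (0 : ℝ)..ζ E, (E - U₀ z) ^ (-(1 / 2) : ℝ)) :
    (∀ E ∈ Set.Ioo Emin (0 : ℝ),
      IntervalIntegrable (fun z => (E - U₀ z) ^ (-(1 / 2) : ℝ))
        MeasureTheory.volume 0 (ζ E)) ∧
    ContinuousOn T (Set.Ioo Emin 0) ∧
    StrictMonoOn T (Set.Ioo Emin 0) := by
  have hmono := sit_U_mono hn m βv hm hβv U₀ hU₀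
  have hTF : ∀ E ∈ Set.Ioo Emin (0 : ℝ), T E = 2 * Real.sqrt 2 * sitF m βv (ζ E) := by
    intro E hE
    rw [hT E hE]
    have h := (sit_scale hn m βv hm hβv U₀ hU₀ (hζ E hE).1).2
    rw [(hζ E hE).2] at h
    rw [h]
  have hζmono : StrictMonoOn ζ (Set.Ioo Emin 0) := by
    intro E hE E' hE' hlt
    have h1 := hζ E hE
    have h2 := hζ E' hE'
    rw [← hmono.lt_iff_lt (Set.mem_Ici.2 h1.1.le) (Set.mem_Ici.2 h2.1.le), h1.2, h2.2]
    exact hlt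
  have himg : Set.Ioi 0 ⊆ ζ '' Set.Ioo Emin 0 := by
    intro x hx
    have hx0 : 0 < x := hx
    have hE : U₀ x ∈ Set.Ioo Emin 0 := by
      constructor
      · rw [hEmin]
        exact hmono (Set.mem_Ici.2 le_rfl) (Set.mem_Ici.2 hx0.le) hx0
      · rw [hU₀, neg_lt_zero]
        refine Finset.sum_pos (fun j _ => ?_) ⟨⟨0, hn⟩, Finset.mem_univ _⟩
        have := hβv j
        have := hm j
        positivity
    exact ⟨U₀ x, hE, hmono.injOn (Set.mem_Ici.2 (hζ _ hE).1.le) (Set.mem_Ici.2 hx0.le)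
      (hζ _ hE).2⟩
  have hpos : 0 < 2 * Real.sqrt 2 := by positivity
  refine ⟨?_, ?_, ?_⟩
  · intro E hE
    have h := (sit_scale hn m βv hm hβv U₀ hU₀ (hζ E hE).1).1
    rw [(hζ E hE).2] at h
    exact h
  · refine ContinuousOn.congr (f := fun E => 2 * Real.sqrt 2 * sitF m βv (ζ E)) ?_ hTF
    intro E hE
    have hc : ContinuousAt ζ E :=
      continuousAt_of_monotoneOn_of_image_mem_nhds hζmono.monotoneOn (Ioo_mem_nhds hE.1 hE.2)
        (Filter.mem_of_superset (Ioi_mem_nhds (hζ E hE).1) himg)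
    have hF : ContinuousAt (fun E => sitF m βv (ζ E)) E :=
      ContinuousAt.comp (f := ζ) (sitF_cont hn m βv hm hβv (hζ E hE).1) hc
    exact (continuousAt_const.mul hF).continuousWithinAt
  · intro E hE E' hE' hlt
    rw [hTF E hE, hTF E' hE']
    exact mul_lt_mul_of_pos_left
      (sitF_lt hn m βv hm hβv (hζ E hE).1.le (hζmono hE hE' hlt)) hpos
end

section
/- The period function satisfies lim_{E → E_min⁺} T(E) = 2π/√β, where β = ∑ⱼ mⱼ/βⱼ³ = U₀''(0). -/
open Real MeasureTheory Filter

lemma term_bounds (m b z w : ℝ) (hm : 0 < m) (hb : 0 < b) (hz : 0 ≤ z) (hzw : z ≤ w) :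
    m / (2 * (Real.sqrt (w ^ 2 + b ^ 2)) ^ 3) * (w ^ 2 - z ^ 2) ≤
      m / Real.sqrt (z ^ 2 + b ^ 2) - m / Real.sqrt (w ^ 2 + b ^ 2) ∧
    m / Real.sqrt (z ^ 2 + b ^ 2) - m / Real.sqrt (w ^ 2 + b ^ 2) ≤
      m / (2 * b ^ 3) * (w ^ 2 - z ^ 2) := by
  have ha2 : Real.sqrt (z ^ 2 + b ^ 2) ^ 2 = z ^ 2 + b ^ 2 := Real.sq_sqrt (by positivity)
  have hc2 : Real.sqrt (w ^ 2 + b ^ 2) ^ 2 = w ^ 2 + b ^ 2 := Real.sq_sqrt (by positivity)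
  have hba : b ≤ Real.sqrt (z ^ 2 + b ^ 2) := Real.le_sqrt_of_sq_le (by nlinarith)
  have hac : Real.sqrt (z ^ 2 + b ^ 2) ≤ Real.sqrt (w ^ 2 + b ^ 2) :=
    Real.sqrt_le_sqrt (by nlinarith)
  have hd : w ^ 2 - z ^ 2 = Real.sqrt (w ^ 2 + b ^ 2) ^ 2 - Real.sqrt (z ^ 2 + b ^ 2) ^ 2 := by
    rw [ha2, hc2]; ring
  have hd0 : 0 ≤ w ^ 2 - z ^ 2 := by nlinarith
  rw [hd] at hd0 ⊢
  clear ha2 hc2 hd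
  generalize Real.sqrt (z ^ 2 + b ^ 2) = a at *
  generalize Real.sqrt (w ^ 2 + b ^ 2) = c at *
  have ha : 0 < a := hb.trans_le hba
  have hc : 0 < c := ha.trans_le hac
  have e : m / a - m / c = m / (a * c * (a + c)) * (c ^ 2 - a ^ 2) := by
    field_simp; ring
  rw [e]
  constructor
  · apply mul_le_mul_of_nonneg_right _ hd0
    apply div_le_div_of_nonneg_left hm.le (by positivity)
    calc a * c * (a + c) ≤ c * c * (c + c) := by gcongr
      _ = 2 * c ^ 3 := by ring
  · apply mul_le_mul_of_nonneg_right _ hd0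
    apply div_le_div_of_nonneg_left hm.le (by positivity)
    have hbc := hba.trans hac
    calc 2 * b ^ 3 = b * b * (b + b) := by ring
      _ ≤ a * c * (a + c) := by gcongr

lemma arcsin_deriv_aux (w z : ℝ) (hz : z ∈ Set.Ioo 0 w) :
    HasDerivAt (fun z => Real.arcsin (z / w)) ((w ^ 2 - z ^ 2) ^ (-(1 / 2) : ℝ)) z := by
  obtain ⟨h0, h1⟩ := hz
  have hw : 0 < w := h0.trans h1
  have hlt : z / w < 1 := (div_lt_one hw).2 h1
  have hgt : -1 < z / w := by have : 0 < z / w := by positivity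
                              linarith
  have h := (Real.hasDerivAt_arcsin hgt.ne' hlt.ne).comp z ((hasDerivAt_id z).div_const w)
  refine HasDerivAt.congr_deriv (f := fun z => Real.arcsin (z / w)) h ?_
  symm
  have hp : 0 < w ^ 2 - z ^ 2 := by nlinarith
  rw [Real.rpow_neg hp.le, ← Real.sqrt_eq_rpow]
  have : 1 - (z / w) ^ 2 = (w ^ 2 - z ^ 2) / w ^ 2 := by field_simp
  rw [this, Real.sqrt_div hp.le, Real.sqrt_sq hw.le]
  have := Real.sqrt_pos.2 hp
  field_simp

lemma arcsin_integrable (w : ℝ) (hw : 0 < w) :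
    IntervalIntegrable (fun z : ℝ => (w ^ 2 - z ^ 2) ^ (-(1 / 2) : ℝ)) volume 0 w := by
  rw [intervalIntegrable_iff_integrableOn_Ioc_of_le hw.le]
  apply intervalIntegral.integrableOn_deriv_of_nonneg (g := fun z => Real.arcsin (z / w))
  · exact (Real.continuous_arcsin.comp (continuous_id.div_const w)).continuousOn
  · exact fun z hz => arcsin_deriv_aux w z hz
  · intro z hz
    have : 0 < w ^ 2 - z ^ 2 := by nlinarith [hz.1, hz.2]
    positivity

lemma arcsin_integral (w : ℝ) (hw : 0 < w) :
    ∫ z in (0:ℝ)..w, (w ^ 2 - z ^ 2) ^ (-(1 / 2) : ℝ) = π / 2 := by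
  rw [intervalIntegral.integral_eq_sub_of_hasDerivAt_of_le hw.le
    (f := fun z => Real.arcsin (z / w))
    (Real.continuous_arcsin.comp (continuous_id.div_const w)).continuousOn
    (fun z hz => arcsin_deriv_aux w z hz) (arcsin_integrable w hw)]
  simp [div_self hw.ne']

/-- squeeze of the period integral -/
lemma integral_bounds (U : ℝ → ℝ) (hU : Continuous U) (w k B : ℝ) (hw : 0 < w) (hk : 0 < k)
    (hB : 0 < B)
    (h : ∀ z, 0 ≤ z → z ≤ w → k * (w ^ 2 - z ^ 2) ≤ U w - U z ∧
      U w - U z ≤ B * (w ^ 2 - z ^ 2)) :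
    B ^ (-(1 / 2) : ℝ) * (π / 2) ≤ ∫ z in (0:ℝ)..w, (U w - U z) ^ (-(1 / 2) : ℝ) ∧
    (∫ z in (0:ℝ)..w, (U w - U z) ^ (-(1 / 2) : ℝ)) ≤ k ^ (-(1 / 2) : ℝ) * (π / 2) := by
  have hint := arcsin_integrable w hw
  have low : ∀ z ∈ Set.Ioo 0 w, B ^ (-(1 / 2) : ℝ) * (w ^ 2 - z ^ 2) ^ (-(1 / 2) : ℝ) ≤
      (U w - U z) ^ (-(1 / 2) : ℝ) := by
    intro z hz
    have hp : 0 < w ^ 2 - z ^ 2 := by nlinarith [hz.1, hz.2]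
    obtain ⟨h1, h2⟩ := h z hz.1.le hz.2.le
    rw [← Real.mul_rpow hB.le hp.le]
    exact Real.rpow_le_rpow_of_nonpos (lt_of_lt_of_le (by positivity) h1) h2 (by norm_num)
  have high : ∀ z ∈ Set.Ioo 0 w, (U w - U z) ^ (-(1 / 2) : ℝ) ≤
      k ^ (-(1 / 2) : ℝ) * (w ^ 2 - z ^ 2) ^ (-(1 / 2) : ℝ) := by
    intro z hz
    have hp : 0 < w ^ 2 - z ^ 2 := by nlinarith [hz.1, hz.2]
    obtain ⟨h1, h2⟩ := h z hz.1.le hz.2.le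
    rw [← Real.mul_rpow hk.le hp.le]
    exact Real.rpow_le_rpow_of_nonpos (by positivity) h1 (by norm_num)
  have hI : IntervalIntegrable (fun z => (U w - U z) ^ (-(1 / 2) : ℝ)) volume 0 w := by
    have hk' := hint.const_mul (k ^ (-(1 / 2) : ℝ))
    rw [intervalIntegrable_iff_integrableOn_Ioo_of_le hw.le] at hk' ⊢
    refine Integrable.mono' hk' ?_ ?_
    · exact ((measurable_const.sub hU.measurable).pow_const _).aestronglyMeasurable
    · refine (ae_restrict_iff' measurableSet_Ioo).2 (Eventually.of_forall fun z hz => ?_)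
      have hp : 0 < w ^ 2 - z ^ 2 := by nlinarith [hz.1, hz.2]
      obtain ⟨h1, h2⟩ := h z hz.1.le hz.2.le
      have h3 : 0 ≤ U w - U z := le_trans (by positivity) h1
      rw [Real.norm_of_nonneg (Real.rpow_nonneg h3 _)]
      exact high z hz
  constructor
  · rw [← arcsin_integral w hw, ← intervalIntegral.integral_const_mul]
    exact intervalIntegral.integral_mono_on_of_le_Ioo hw.le (hint.const_mul _) hI low
  · rw [← arcsin_integral w hw, ← intervalIntegral.integral_const_mul]
    exact intervalIntegral.integral_mono_on_of_le_Ioo hw.le hI (hint.const_mul _) high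

/-- The period function
`T(E) = 2√2 ∫₀^{ζ(E)} (E - U₀(z))^{-1/2} dz` tends to `2π/√β` as `E → E_min⁺`,
where `β = ∑ⱼ mⱼ/βⱼ³ = U₀''(0)`. -/
theorem period_function_limit_at_Emin
    (n : ℕ) (hn : 1 ≤ n)
    (m βv : Fin n → ℝ) (hm : ∀ j, 0 < m j) (hβv : ∀ j, 0 < βv j)
    (U₀ : ℝ → ℝ)
    (hU₀ : ∀ z : ℝ, U₀ z = -∑ j, m j / Real.sqrt (z ^ 2 + βv j ^ 2))
    (β : ℝ) (hβ : β = ∑ j, m j / βv j ^ 3)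
    (Emin : ℝ) (hEmin : Emin = U₀ 0)
    (ζ : ℝ → ℝ)
    (hζ : ∀ E ∈ Set.Ioo Emin (0 : ℝ), 0 < ζ E ∧ U₀ (ζ E) = E)
    (T : ℝ → ℝ)
    (hT : ∀ E ∈ Set.Ioo Emin (0 : ℝ),
      T E = 2 * Real.sqrt 2 * ∫ z in (0 : ℝ)..ζ E, (E - U₀ z) ^ (-(1 / 2) : ℝ)) :
    Tendsto T (nhdsWithin Emin (Set.Ioi Emin)) (nhds (2 * π / Real.sqrt β)) := by
  have : Nonempty (Fin n) := ⟨⟨0, hn⟩⟩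
  have hUc : Continuous U₀ := by
    have : U₀ = fun z => -∑ j, m j / Real.sqrt (z ^ 2 + βv j ^ 2) := funext hU₀
    rw [this]
    refine (continuous_finsetSum _ fun j _ => ?_).neg
    refine continuous_const.div (by fun_prop) fun z => ?_
    have := hβv j
    positivity
  set k : ℝ → ℝ := fun w => ∑ j, m j / (2 * (Real.sqrt (w ^ 2 + βv j ^ 2)) ^ 3) with hk
  have hkc : Continuous k := by
    refine continuous_finsetSum _ fun j _ => ?_
    refine continuous_const.div (by fun_prop) fun z => ?_
    have := hβv j
    positivity
  have hkpos : ∀ w, 0 < k w := fun w => by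
    refine Finset.sum_pos (fun j _ => ?_) Finset.univ_nonempty
    have := hβv j
    have := hm j
    positivity
  have hβ2 : β / 2 = ∑ j, m j / (2 * βv j ^ 3) := by
    rw [hβ, Finset.sum_div]
    refine Finset.sum_congr rfl fun j _ => ?_
    have := hβv j
    field_simp
  have hk0 : k 0 = β / 2 := by
    rw [hβ2]
    refine Finset.sum_congr rfl fun j _ => ?_
    simp [Real.sqrt_sq (hβv j).le]
  have hB : 0 < β / 2 := hk0 ▸ hkpos 0
  have hβpos : 0 < β := by linarith
  have hbd : ∀ w z, 0 ≤ z → z ≤ w → k w * (w ^ 2 - z ^ 2) ≤ U₀ w - U₀ z ∧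
      U₀ w - U₀ z ≤ β / 2 * (w ^ 2 - z ^ 2) := by
    intro w z hz hzw
    have e : U₀ w - U₀ z = ∑ j, (m j / Real.sqrt (z ^ 2 + βv j ^ 2) -
        m j / Real.sqrt (w ^ 2 + βv j ^ 2)) := by
      rw [hU₀, hU₀, Finset.sum_sub_distrib]; ring
    rw [e, hβ2, hk, Finset.sum_mul, Finset.sum_mul]
    exact ⟨Finset.sum_le_sum fun j _ => (term_bounds _ _ z w (hm j) (hβv j) hz hzw).1,
      Finset.sum_le_sum fun j _ => (term_bounds _ _ z w (hm j) (hβv j) hz hzw).2⟩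
  have hmono : ∀ z w, 0 ≤ z → z < w → U₀ z < U₀ w := by
    intro z w hz hzw
    have h1 := (hbd w z hz hzw.le).1
    have : 0 < k w * (w ^ 2 - z ^ 2) := mul_pos (hkpos w) (by nlinarith)
    linarith
  have hE0 : Emin < 0 := by
    rw [hEmin, hU₀, neg_lt_zero]
    refine Finset.sum_pos (fun j _ => ?_) Finset.univ_nonempty
    have := hβv j
    have := hm j
    positivity
  have hev : ∀ᶠ E in nhdsWithin Emin (Set.Ioi Emin), E ∈ Set.Ioo Emin 0 :=
    Ioo_mem_nhdsGT hE0
  have hζ0 : Tendsto ζ (nhdsWithin Emin (Set.Ioi Emin)) (nhds 0) := by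
    rw [Metric.tendsto_nhds]
    intro ε hε
    have hlt : Emin < U₀ ε := hEmin ▸ hmono 0 ε le_rfl hε
    have hev2 : ∀ᶠ E in nhdsWithin Emin (Set.Ioi Emin), E ∈ Set.Ioo Emin (U₀ ε) :=
      Ioo_mem_nhdsGT hlt
    filter_upwards [hev, hev2] with E h1 h2
    obtain ⟨h3, h4⟩ := hζ E h1
    rw [Real.dist_eq, sub_zero, abs_of_pos h3]
    by_contra hcon
    rcases (not_lt.1 hcon).eq_or_lt with h | h
    · rw [h, h4] at h2; exact lt_irrefl _ h2.2
    · have := hmono _ _ hε.le h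
      rw [h4] at this
      exact lt_asymm this h2.2
  have hval : 2 * Real.sqrt 2 * ((β / 2) ^ (-(1 / 2) : ℝ) * (π / 2)) = 2 * π / Real.sqrt β := by
    rw [Real.rpow_neg hB.le, ← Real.sqrt_eq_rpow, Real.sqrt_div hβpos.le]
    have h1 := Real.sqrt_pos.2 hβpos
    have h2 : Real.sqrt 2 ^ 2 = 2 := Real.sq_sqrt (by norm_num)
    have h3 : 0 < Real.sqrt 2 := by positivity
    field_simp
    exact h2
  have hlimk : Tendsto (fun E => 2 * Real.sqrt 2 * ((k (ζ E)) ^ (-(1 / 2) : ℝ) * (π / 2)))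
      (nhdsWithin Emin (Set.Ioi Emin)) (nhds (2 * π / Real.sqrt β)) := by
    rw [← hval]
    have h1 : Tendsto (fun E => k (ζ E)) (nhdsWithin Emin (Set.Ioi Emin)) (nhds (β / 2)) := by
      rw [← hk0]
      exact (hkc.tendsto 0).comp hζ0
    exact ((h1.rpow_const (Or.inl hB.ne')).mul_const _).const_mul _
  refine tendsto_of_tendsto_of_tendsto_of_le_of_le' tendsto_const_nhds hlimk ?_ ?_
  · filter_upwards [hev] with E hE
    obtain ⟨h3, h4⟩ := hζ E hE
    have h := (integral_bounds U₀ hUc (ζ E) _ _ h3 (hkpos _) hB (hbd (ζ E))).1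
    rw [h4] at h
    rw [hT E hE, ← hval]
    exact mul_le_mul_of_nonneg_left h (by positivity)
  · filter_upwards [hev] with E hE
    obtain ⟨h3, h4⟩ := hζ E hE
    have h := (integral_bounds U₀ hUc (ζ E) _ _ h3 (hkpos _) hB (hbd (ζ E))).2
    rw [h4] at h
    rw [hT E hE]
    exact mul_le_mul_of_nonneg_left h (by positivity)
end

section
/- Let 𝔮 be a positive integer and let w : ℝ → ℝ be a nonconstant C² solution of ẅ = −U₀'(w) with ẇ(0) = 0, of energy E₀ = ½ẇ(t)² + U₀(w(t)) ∈ (E_min, 0), whose minimal period is T(E₀) and which is 2π𝔮-periodic (so T(E₀) = 2π𝔮/𝔭 for some positive integer 𝔭). Assume the period function T is differentiable at E₀ with T'(E₀) > 0. Then the real vector space of C² 2π𝔮-periodic solutions y : ℝ → ℝ of the variational equation ÿ(t) = −U₀''(w(t)) y(t) is one-dimensional, and it is spanned by ẇ. -/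
open Real MeasureTheory


lemma aux_int_inv_sqrt_abs (ζ a b : ℝ) :
    IntervalIntegrable (fun z : ℝ => 1 / √|z - ζ|) volume a b := by
  have h1 : ∀ c d : ℝ, IntervalIntegrable (fun x : ℝ => x ^ (-(1/2) : ℝ)) volume c d :=
    fun c d => intervalIntegral.intervalIntegrable_rpow' (by norm_num)
  have h2 := (h1 (a - ζ) (b - ζ)).comp_sub_right ζ
  have h3 := (h1 (ζ - a) (ζ - b)).comp_sub_left ζ
  simp only [sub_add_cancel, sub_sub_cancel] at h2 h3
  have key : ∀ x : ℝ, 0 ≤ x → x ^ (-(1/2) : ℝ) = 1 / √x := by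
    intro x hx
    rw [Real.rpow_neg hx, ← Real.sqrt_eq_rpow, one_div]
  have key2 : ∀ x : ℝ, x ≤ 0 → x ^ (-(1/2) : ℝ) = 0 := by
    intro x hx
    rcases hx.lt_or_eq with h | h
    · rw [Real.rpow_def_of_neg h]
      have : Real.cos (-(1/2) * π) = 0 := by
        rw [neg_mul, Real.cos_neg, one_div_mul_eq_div, Real.cos_pi_div_two]
      rw [this, mul_zero]
    · rw [h, Real.zero_rpow (by norm_num)]
  refine (h2.add h3).congr ?_
  intro z _
  show (z - ζ) ^ (-(1/2) : ℝ) + (ζ - z) ^ (-(1/2) : ℝ) = 1 / √|z - ζ|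
  rcases le_total ζ z with h | h
  · rw [key _ (by linarith), key2 (ζ - z) (by linarith), abs_of_nonneg (by linarith), add_zero]
  · rw [key2 _ (by linarith), key (ζ - z) (by linarith), abs_of_nonpos (by linarith), zero_add,
      neg_sub]

lemma aux_int_sing (U : ℝ → ℝ) (hU : ContDiff ℝ 1 U) (hev : ∀ z, U (-z) = U z)
    (hmono : StrictMonoOn U (Set.Ici 0)) (hpos : ∀ z, 0 < z → 0 < deriv U z)
    (ζ : ℝ) (hζ : 0 < ζ) (a b : ℝ) :
    IntervalIntegrable (fun z : ℝ => 1 / √|U ζ - U z|) volume a b := by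
  have hd : Differentiable ℝ U := hU.differentiable one_ne_zero
  have hcont : Continuous (dslope U ζ) := by
    rw [← continuousOn_univ, continuousOn_dslope Filter.univ_mem]
    exact ⟨hU.continuous.continuousOn, hd ζ⟩
  have hmeas : Measurable (fun z : ℝ => 1 / √|U ζ - U z|) := by
    have := hU.continuous.measurable
    fun_prop
  have main : ∀ M, 0 < M → IntervalIntegrable (fun z : ℝ => 1 / √|U ζ - U z|) volume 0 M := by
    intro M hM
    obtain ⟨x0, hx0, hmin⟩ := (isCompact_Icc (a := (0:ℝ)) (b := M)).exists_isMinOn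
      ⟨0, by simp [hM.le]⟩ hcont.continuousOn
    have hp : ∀ z, 0 ≤ z → 0 < dslope U ζ z := by
      intro z hz
      by_cases h : z = ζ
      · rw [h, dslope_same]; exact hpos ζ hζ
      · rw [dslope_of_ne _ h, slope_def_field]
        rcases lt_or_gt_of_ne h with h | h
        · exact div_pos_of_neg_of_neg (by linarith [hmono hz hζ.le h]) (by linarith)
        · exact div_pos (by linarith [hmono hζ.le hz h]) (by linarith)
    have hc := hp x0 hx0.1
    set c := dslope U ζ x0
    have hb : ∀ z ∈ Set.Icc 0 M, c * |z - ζ| ≤ |U ζ - U z| := by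
      intro z hz
      have h1 : (z - ζ) * dslope U ζ z = U z - U ζ := by
        simpa using sub_smul_dslope U ζ z
      have h2 : c ≤ dslope U ζ z := hmin hz
      rw [abs_sub_comm (U ζ), ← h1, abs_mul, abs_of_pos (hp z hz.1), mul_comm]
      gcongr
    have := (aux_int_inv_sqrt_abs ζ 0 M).const_mul (1 / √c)
    refine this.mono_fun' hmeas.aestronglyMeasurable ?_
    have hne : ∀ᵐ z : ℝ, z ≠ ζ := by simp [ae_iff]
    rw [Filter.EventuallyLE, ae_restrict_iff' measurableSet_uIoc]
    filter_upwards [hne] with z hz hzM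
    rw [Set.uIoc_of_le hM.le] at hzM
    have h3 := hb z ⟨hzM.1.le, hzM.2⟩
    have h4 : 0 < |z - ζ| := abs_pos.2 (sub_ne_zero.2 hz)
    rw [Real.norm_of_nonneg (by positivity), one_div_mul_one_div, ← Real.sqrt_mul hc.le]
    apply one_div_le_one_div_of_le
    · positivity
    · exact Real.sqrt_le_sqrt h3
  have := fun t => intervalIntegrable_of_even₀ (t := t) (f := fun z : ℝ => 1 / √|U ζ - U z|)
    (fun x => by simp [hev]) (fun x hx => main x hx) (by simp)
  exact (this a).symm.trans (this b)

lemma aux_int_sing2 (U : ℝ → ℝ) (hU : ContDiff ℝ 1 U) (hev : ∀ z, U (-z) = U z)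
    (hmono : StrictMonoOn U (Set.Ici 0)) (hpos : ∀ z, 0 < z → 0 < deriv U z)
    (ζ : ℝ) (hζ : 0 < ζ) (a b : ℝ) :
    IntervalIntegrable (fun z : ℝ => 1 / √(U ζ - U z)) volume a b := by
  refine (aux_int_sing U hU hev hmono hpos ζ hζ a b).mono_fun ?_ ?_
  · have hmeas : Measurable (fun z : ℝ => 1 / √(U ζ - U z)) := by
      have := hU.continuous.measurable
      fun_prop
    exact hmeas.aestronglyMeasurable
  · refine Filter.Eventually.of_forall fun z => ?_
    simp only [Real.norm_of_nonneg (one_div_nonneg.2 (Real.sqrt_nonneg _))]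
    rcases le_total (U ζ - U z) 0 with h | h
    · rw [Real.sqrt_eq_zero_of_nonpos h]; simp
    · rw [abs_of_nonneg h]

/-- integration by parts -/
lemma aux_parts (U φ : ℝ → ℝ) (hU : ContDiff ℝ 1 U) (hev : ∀ z, U (-z) = U z)
    (hmono : StrictMonoOn U (Set.Ici 0)) (hpos : ∀ z, 0 < z → 0 < deriv U z)
    (hφ : ContDiff ℝ 1 φ) (hUφ : ∀ z, deriv U z * φ z = U z - U 0) (hφ0 : φ 0 = 0)
    (ζ : ℝ) (hζ : 0 < ζ) :
    (U ζ - U 0) * ∫ z in (0:ℝ)..ζ, 1 / √(U ζ - U z) =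
      ∫ z in (0:ℝ)..ζ, √(U ζ - U z) * (1 + 2 * deriv φ z) := by
  have hUc := hU.continuous
  have hφc := hφ.continuous
  have hφc' := hφ.continuous_deriv le_rfl
  have hI := aux_int_sing2 U hU hev hmono hpos ζ hζ 0 ζ
  have e1 : IntervalIntegrable (fun z => (1 / √(U ζ - U z)) * (U z - U 0)) volume 0 ζ :=
    hI.mul_continuousOn (by fun_prop)
  have e2 : IntervalIntegrable (fun z => √(U ζ - U z) * (2 * deriv φ z)) volume 0 ζ :=
    (Continuous.intervalIntegrable (by fun_prop) _ _)
  have e3 : IntervalIntegrable (fun z => √(U ζ - U z) * (1 + 2 * deriv φ z)) volume 0 ζ :=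
    (Continuous.intervalIntegrable (by fun_prop) _ _)
  have hlt : ∀ z ∈ Set.Ioo 0 ζ, 0 < U ζ - U z := fun z hz => by
    have := hmono (a := z) (b := ζ) hz.1.le hζ.le hz.2
    linarith
  have h := intervalIntegral.integral_eq_sub_of_hasDerivAt_of_le
    (f := fun z => -2 * (√(U ζ - U z) * φ z))
    (f' := fun z => (1 / √(U ζ - U z)) * (U z - U 0) - √(U ζ - U z) * (2 * deriv φ z)) hζ.le
    (by fun_prop) (fun z hz => by
      have h0 := hlt z hz
      have h1 : HasDerivAt U (deriv U z) z := (hU.differentiable one_ne_zero z).hasDerivAt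
      have h2 : HasDerivAt φ (deriv φ z) z := (hφ.differentiable one_ne_zero z).hasDerivAt
      have h3 := (((h1.const_sub (U ζ)).sqrt h0.ne').mul h2).const_mul (-2)
      refine h3.congr_deriv ?_
      have : √(U ζ - U z) ≠ 0 := (Real.sqrt_pos.2 h0).ne'
      rw [← hUφ]
      field_simp
      ring) (e1.sub e2)
  simp only [sub_self, Real.sqrt_zero, hφ0, mul_zero, zero_mul] at h
  rw [← sub_eq_zero, ← intervalIntegral.integral_const_mul,
    ← intervalIntegral.integral_sub (hI.const_mul _) e3]
  have : ∫ z in (0:ℝ)..ζ, ((U ζ - U 0) * (1 / √(U ζ - U z)) - √(U ζ - U z) * (1 + 2 * deriv φ z))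
     = ∫ z in (0:ℝ)..ζ, ((1 / √(U ζ - U z)) * (U z - U 0) - √(U ζ - U z) * (2 * deriv φ z)) := by
    apply intervalIntegral.integral_congr
    intro z hz
    rw [Set.uIcc_of_le hζ.le] at hz
    have h0 : 0 ≤ U ζ - U z := sub_nonneg.2 (hmono.monotoneOn hz.1 hζ.le hz.2)
    have h5 : √(U ζ - U z) = (U ζ - U z) * (1 / √(U ζ - U z)) := by
      rw [mul_one_div, Real.div_sqrt]
    simp only
    linear_combination (-1 : ℝ) * h5
  rw [this, h]

lemma aux_sqrt_lip (x y : ℝ) (hy0 : y ≠ 0) : |√x - √y| ≤ 1 / √|y| * |x - y| := by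
  have hs : 0 < √|y| := Real.sqrt_pos.2 (abs_pos.2 hy0)
  rw [one_div_mul_eq_div, le_div_iff₀ hs]
  rcases lt_or_gt_of_ne hy0 with hy | hy
  · rw [Real.sqrt_eq_zero_of_nonpos hy.le, sub_zero, abs_of_neg hy, abs_of_nonneg (Real.sqrt_nonneg _)]
    rcases le_total x 0 with hx | hx
    · rw [Real.sqrt_eq_zero_of_nonpos hx]; simp
    · rw [abs_of_nonneg (by linarith)]
      have h1 := Real.sq_sqrt hx
      have h2 := Real.sq_sqrt (neg_nonneg.2 hy.le)
      nlinarith [sq_nonneg (√x - √(-y))]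
  · rw [abs_of_pos hy]
    rcases le_total x 0 with hx | hx
    · rw [Real.sqrt_eq_zero_of_nonpos hx, zero_sub, abs_neg, abs_of_nonneg (Real.sqrt_nonneg _),
        Real.mul_self_sqrt hy.le, abs_of_nonpos (by linarith)]
      linarith
    · have h1 := Real.sq_sqrt hx
      have h2 := Real.sq_sqrt hy.le
      have : x - y = (√x - √y) * (√x + √y) := by linear_combination h2 - h1
      rw [this, abs_mul, abs_of_nonneg (a := √x + √y) (by positivity)]
      gcongr
      linarith [Real.sqrt_nonneg x]

lemma aux_deriv_integral (U χ : ℝ → ℝ) (hU : ContDiff ℝ 1 U) (hev : ∀ z, U (-z) = U z)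
    (hmono : StrictMonoOn U (Set.Ici 0)) (hpos : ∀ z, 0 < z → 0 < deriv U z)
    (hχ : Continuous χ) (ζ : ℝ) (hζ : 0 < ζ) (M : ℝ) (hM : 0 < M) :
    HasDerivAt (fun E => ∫ z in (0:ℝ)..M, √(E - U z) * χ z)
      (∫ z in (0:ℝ)..M, 1 / (2 * √(U ζ - U z)) * χ z) (U ζ) := by
  have hUc := hU.continuous
  have hUm := hUc.measurable
  have hχm := hχ.measurable
  simp only [intervalIntegral.integral_of_le hM.le]
  set L : ℝ →L[ℝ] ℝ →L[ℝ] ℝ := ContinuousLinearMap.smulRightL ℝ ℝ ℝ 1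
  have hI1 : IntegrableOn (fun z => 1 / (2 * √(U ζ - U z)) * χ z) (Set.Ioc 0 M) := by
    have := (((aux_int_sing2 U hU hev hmono hpos ζ hζ 0 M).mul_continuousOn
      hχ.continuousOn).const_mul (1/2)).1
    refine this.congr (Filter.Eventually.of_forall fun z => ?_)
    show 1 / 2 * (1 / √(U ζ - U z) * χ z) = _
    rw [← mul_assoc, one_div_mul_one_div]
  have hne : ∀ᵐ z : ℝ ∂(volume.restrict (Set.Ioc 0 M)), 0 < z ∧ z ≠ ζ := by
    rw [ae_restrict_iff' measurableSet_Ioc]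
    have hne : ∀ᵐ z : ℝ, z ≠ ζ := by simp [ae_iff]
    filter_upwards [hne] with z hz hz2 using ⟨hz2.1, hz⟩
  have hUne : ∀ z, 0 < z → z ≠ ζ → U ζ - U z ≠ 0 := fun z h0 h1 h2 =>
    h1 (hmono.injOn h0.le hζ.le (by linarith))
  have key := hasFDerivAt_integral_of_dominated_loc_of_lip' (𝕜 := ℝ)
    (μ := volume.restrict (Set.Ioc 0 M))
    (F := fun E z => √(E - U z) * χ z) (x₀ := U ζ) (s := Set.univ)
    (F' := fun z => L (1 / (2 * √(U ζ - U z)) * χ z))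
    (bound := fun z => 1 / √|U ζ - U z| * |χ z|)
    Filter.univ_mem
    (fun E _ => by
      have : Continuous (fun z => √(E - U z) * χ z) := by fun_prop
      exact this.aestronglyMeasurable)
    ((Continuous.intervalIntegrable (by fun_prop) 0 M).1)
    (L.continuous.comp_aestronglyMeasurable hI1.aestronglyMeasurable)
    (by
      filter_upwards [hne] with z hz E _
      show ‖√(E - U z) * χ z - √(U ζ - U z) * χ z‖ ≤ _
      rw [← sub_mul, norm_mul, Real.norm_eq_abs, Real.norm_eq_abs, Real.norm_eq_abs, mul_right_comm]
      have := aux_sqrt_lip (E - U z) (U ζ - U z) (hUne z hz.1 hz.2)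
      rw [show E - U z - (U ζ - U z) = E - U ζ by ring] at this
      gcongr)
    (((aux_int_sing U hU hev hmono hpos ζ hζ 0 M).mul_continuousOn hχ.abs.continuousOn).1)
    (by
      filter_upwards [hne] with z hz
      have := ((((hasDerivAt_id (U ζ)).sub_const (U z)).sqrt (hUne z hz.1 hz.2)).mul_const (χ z))
      exact this.hasFDerivAt)
  have k2 := key.2
  rw [ContinuousLinearMap.integral_comp_comm _ hI1] at k2
  exact k2

lemma aux_countable (v : ℝ → ℝ) (hv : ∀ t, v t = 0 → ∃ v', v' ≠ 0 ∧ HasDerivAt v v' t) :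
    {t | v t = 0}.Countable := by
  refine (countable_setOfPred_isolated_right_within (s := {t | v t = 0})).mono ?_
  intro t ht
  refine ⟨ht, ?_⟩
  obtain ⟨v', h0, h1⟩ := hv t ht
  have h2 := h1.eventually_ne (c := (0:ℝ)) h0
  rw [← Filter.empty_mem_iff_bot]
  have h3 : ∀ᶠ z in nhdsWithin t ({t | v t = 0} ∩ Set.Ioi t), v z ≠ 0 :=
    h2.filter_mono (nhdsWithin_mono t (fun z hz => ne_of_gt hz.2))
  filter_upwards [h3, self_mem_nhdsWithin] with z h4 h5
  exact h4 h5.1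

lemma aux_time_average (U : ℝ → ℝ) (hU : ContDiff ℝ 1 U) (hev : ∀ z, U (-z) = U z)
    (hmono : StrictMonoOn U (Set.Ici 0)) (hpos : ∀ z, 0 < z → 0 < deriv U z)
    (ζ : ℝ) (hζ : 0 < ζ) (w : ℝ → ℝ) (hw : ContDiff ℝ 2 w)
    (hweq : ∀ t : ℝ, deriv (deriv w) t = -deriv U (w t))
    (henergy : ∀ t : ℝ, 1 / 2 * (deriv w t) ^ 2 + U (w t) = U ζ)
    (P : ℝ) (hP : Function.Periodic w P) (f : ℝ → ℝ) (hf : Continuous f)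
    (hfe : ∀ z, f (-z) = f z)
    (h0 : ∫ z in (0:ℝ)..ζ, 1 / √(U ζ - U z) * f z = 0) (t : ℝ) :
    ∫ s in t..(t + P), f (w s) = 0 := by
  have hUc := hU.continuous
  have hwd : Differentiable ℝ w := hw.differentiable two_ne_zero
  have hw1 : ContDiff ℝ 1 (deriv w) := (contDiff_succ_iff_deriv.1 (show ContDiff ℝ (1+1) w from hw)).2.2
  have hwd1 : Differentiable ℝ (deriv w) := hw1.differentiable one_ne_zero
  have habs : ∀ z, U |z| = U z := fun z => by
    rcases abs_choice z with h | h <;> rw [h]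
    exact hev z
  -- turning points
  have hturn : ∀ s, deriv w s = 0 → w s = ζ ∨ w s = -ζ := by
    intro s hs
    have h1 := henergy s
    rw [hs] at h1
    have h2 : U |w s| = U ζ := by rw [habs]; linarith
    have h3 := hmono.injOn (abs_nonneg (w s)) hζ.le h2
    exact eq_or_eq_neg_of_abs_eq h3
  have hdodd : ∀ z, deriv U (-z) = - deriv U z := by
    intro z
    have h1 : (fun x => U (-x)) = U := funext hev
    have h2 := deriv_comp_neg U z
    rw [h1] at h2
    linarith
  have hcount : {s | deriv w s = 0}.Countable := by
    apply aux_countable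
    intro s hs
    refine ⟨deriv (deriv w) s, ?_, (hwd1 s).hasDerivAt⟩
    rw [hweq]
    have := hpos ζ hζ
    rcases hturn s hs with h | h <;> rw [h]
    · linarith
    · rw [hdodd]; linarith
  have hI : ∀ a b, IntervalIntegrable (fun z => 1 / √(U ζ - U z) * f z) volume a b := fun a b =>
    (aux_int_sing2 U hU hev hmono hpos ζ hζ a b).mul_continuousOn hf.continuousOn
  set K : ℝ → ℝ := fun z => ∫ x in (0:ℝ)..z, 1 / √(U ζ - U x) * f x with hK
  have hKc : Continuous K := intervalIntegral.continuous_primitive hI 0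
  have hK1 : K ζ = 0 := h0
  have hK2 : K (-ζ) = 0 := by
    have h1 := intervalIntegral.integral_comp_neg (a := (0:ℝ)) (b := ζ)
      (fun z => 1 / √(U ζ - U z) * f z)
    simp only [hev, hfe, neg_zero] at h1
    rw [h0] at h1
    show ∫ x in (0:ℝ)..(-ζ), 1 / √(U ζ - U x) * f x = 0
    rw [intervalIntegral.integral_symm, ← h1, neg_zero]
  have hmeas : Measurable (fun z => 1 / √(U ζ - U z) * f z) := by
    have := hUc.measurable
    have := hf.measurable
    fun_prop
  set G : ℝ → ℝ := fun s => K (w s) * Real.sign (deriv w s) with hG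
  have hder : ∀ s, deriv w s ≠ 0 → HasDerivAt G (√2 * f (w s)) s := by
    intro s hs
    have h1 : U ζ - U (w s) = (deriv w s) ^ 2 / 2 := by linarith [henergy s]
    have h2 : 0 < U ζ - U (w s) := by rw [h1]; positivity
    have hca : ContinuousAt (fun z => 1 / √(U ζ - U z) * f z) (w s) := by
      have : √(U ζ - U (w s)) ≠ 0 := (Real.sqrt_pos.2 h2).ne'
      fun_prop (disch := assumption)
    have hKd : HasDerivAt K (1 / √(U ζ - U (w s)) * f (w s)) (w s) :=
      intervalIntegral.integral_hasDerivAt_right (hI _ _)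
        (hmeas.stronglyMeasurable.stronglyMeasurableAtFilter) hca
    have h3 := (hKd.comp s (hwd s).hasDerivAt).mul_const (Real.sign (deriv w s))
    have h4 : √(U ζ - U (w s)) = |deriv w s| / √2 := by
      rw [h1, Real.sqrt_div (sq_nonneg _), Real.sqrt_sq_eq_abs]
    have h5 : HasDerivAt (fun x => (K ∘ w) x * Real.sign (deriv w s)) (√2 * f (w s)) s := by
      refine h3.congr_deriv ?_
      rw [h4]
      rcases lt_or_gt_of_ne hs with h | h
      · rw [Real.sign_of_neg h, abs_of_neg h]; field_simp
      · rw [Real.sign_of_pos h, abs_of_pos h]; field_simp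
    refine h5.congr_of_eventuallyEq ?_
    have hcd := hwd1.continuous.continuousAt (x := s)
    rcases lt_or_gt_of_ne hs with h | h
    · filter_upwards [hcd.eventually (gt_mem_nhds h)] with x hx
      simp only [hG, Function.comp, Real.sign_of_neg hx, Real.sign_of_neg h]
    · filter_upwards [hcd.eventually (lt_mem_nhds h)] with x hx
      simp only [hG, Function.comp, Real.sign_of_pos hx, Real.sign_of_pos h]
  have hGc : Continuous G := by
    rw [continuous_iff_continuousAt]
    intro s
    by_cases hs : deriv w s = 0
    · have hKw : K (w s) = 0 := by rcases hturn s hs with h | h <;> rw [h] <;> assumption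
      have hG0 : G s = 0 := by simp [hG, hKw]
      rw [ContinuousAt, hG0]
      refine squeeze_zero_norm (a := fun x => |K (w x)|) ?_ ?_
      · intro x
        rw [Real.norm_eq_abs, abs_mul]
        refine mul_le_of_le_one_right (abs_nonneg _) ?_
        rcases Real.sign_apply_eq (deriv w x) with h | h | h <;> rw [h] <;> simp
      · have : Continuous (fun x => |K (w x)|) := by
          have := hwd.continuous
          fun_prop
        have h2 := this.tendsto s
        simpa only [hKw, abs_zero] using h2
    · exact (hder s hs).continuousAt
  have hftc := integral_eq_of_hasDerivAt_off_countable G (fun s => √2 * f (w s))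
    (a := t) (b := t + P) hcount hGc.continuousOn
    (fun x hx => hder x hx.2)
    (Continuous.intervalIntegrable (by have := hwd.continuous; fun_prop) _ _)
  have hGP : G (t + P) = G t := by
    have h1 : deriv w (t + P) = deriv w t := by
      rw [← deriv_comp_add_const]
      congr 1
      exact funext hP
    simp only [hG]
    rw [hP t, h1]
  rw [hGP, sub_self, intervalIntegral.integral_const_mul] at hftc
  have : √(2:ℝ) ≠ 0 := by positivity
  exact (mul_eq_zero.1 hftc).resolve_left this

lemma aux_T_deriv (U φ : ℝ → ℝ) (hU : ContDiff ℝ 1 U) (hev : ∀ z, U (-z) = U z)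
    (hmono : StrictMonoOn U (Set.Ici 0)) (hpos : ∀ z, 0 < z → 0 < deriv U z)
    (hφ : ContDiff ℝ 1 φ) (hUφ : ∀ z, deriv U z * φ z = U z - U 0) (hφ0 : φ 0 = 0)
    (ζ : ℝ → ℝ) (hζ : ∀ E ∈ Set.Ioo (U 0) (0 : ℝ), 0 < ζ E ∧ U (ζ E) = E)
    (T : ℝ → ℝ)
    (hT : ∀ E ∈ Set.Ioo (U 0) (0 : ℝ),
      T E = 2 * Real.sqrt 2 * ∫ z in (0 : ℝ)..ζ E, (E - U z) ^ (-(1 / 2) : ℝ))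
    (E₀ : ℝ) (hE₀ : E₀ ∈ Set.Ioo (U 0) (0 : ℝ))
    (T' : ℝ) (hT' : HasDerivAt T T' E₀) :
    (E₀ - U 0) * T' = 2 * √2 * ∫ z in (0 : ℝ)..ζ E₀,
      1 / √(U (ζ E₀) - U z) * (deriv φ z - 1 / 2) := by
  have hUc := hU.continuous
  have hφc' := hφ.continuous_deriv le_rfl
  have hTs : ∀ E ∈ Set.Ioo (U 0) (0 : ℝ),
      T E = 2 * √2 * ∫ z in (0 : ℝ)..ζ E, 1 / √(U (ζ E) - U z) := by
    intro E hE
    obtain ⟨h1, h2⟩ := hζ E hE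
    rw [hT E hE]
    congr 1
    apply intervalIntegral.integral_congr
    intro z hz
    rw [Set.uIcc_of_le h1.le] at hz
    have h0 : 0 ≤ E - U z := by
      have := hmono.monotoneOn hz.1 h1.le hz.2
      linarith
    simp only [h2]
    rw [Real.rpow_neg h0, ← Real.sqrt_eq_rpow, one_div]
  obtain ⟨hz0, hUz0⟩ := hζ E₀ hE₀
  set M := ζ E₀ + 1 with hM
  have hM0 : 0 < M := by linarith
  have hUM : E₀ < U M := by
    rw [← hUz0]; exact hmono hz0.le hM0.le (by linarith)
  -- beyond the turning point nothing contributes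
  have htail : ∀ (E z : ℝ), E ∈ Set.Ioo (U 0) (0 : ℝ) → ζ E ≤ z → √(E - U z) = 0 := by
    intro E z hE hz
    obtain ⟨h1, h2⟩ := hζ E hE
    apply Real.sqrt_eq_zero_of_nonpos
    have := hmono.monotoneOn h1.le (show (0:ℝ) ≤ z by linarith) hz
    linarith
  have hform : ∀ E ∈ Set.Ioo (U 0) (0 : ℝ), E < U M →
      (E - U 0) * T E = 2 * √2 * ∫ z in (0:ℝ)..M, √(E - U z) * (1 + 2 * deriv φ z) := by
    intro E hE hEM
    obtain ⟨h1, h2⟩ := hζ E hE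
    have hle : ζ E ≤ M := by
      by_contra! h
      have := hmono hM0.le h1.le h
      linarith
    have hc : Continuous (fun z => √(E - U z) * (1 + 2 * deriv φ z)) := by fun_prop
    rw [hTs E hE, mul_left_comm, ← intervalIntegral.integral_add_adjacent_intervals
      (hc.intervalIntegrable 0 (ζ E)) (hc.intervalIntegrable (ζ E) M)]
    have hz : ∫ z in (ζ E)..M, √(E - U z) * (1 + 2 * deriv φ z) = 0 := by
      rw [← intervalIntegral.integral_zero (a := ζ E) (b := M) (μ := volume)]
      apply intervalIntegral.integral_congr
      intro z hz
      rw [Set.uIcc_of_le hle] at hz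
      simp only [htail E z hE hz.1, zero_mul]
    have := aux_parts U φ hU hev hmono hpos hφ hUφ hφ0 (ζ E) h1
    rw [h2] at this
    rw [hz, add_zero, h2, this]
  have hd1 := ((hasDerivAt_id E₀).sub_const (U 0)).mul hT'
  have hd2 := (aux_deriv_integral U (fun z => 1 + 2 * deriv φ z) hU hev hmono hpos (by fun_prop)
    (ζ E₀) hz0 M hM0).const_mul (2 * √2)
  rw [hUz0] at hd2
  have heq : (fun E => 2 * √2 * ∫ z in (0:ℝ)..M, √(E - U z) * (1 + 2 * deriv φ z)) =ᶠ[nhds E₀]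
      ((fun x => id x - U 0) * T) := by
    filter_upwards [isOpen_Ioo.mem_nhds hE₀, gt_mem_nhds hUM] with E h1 h2
    exact (hform E h1 h2).symm
  have hu := hd1.unique (hd2.congr_of_eventuallyEq heq.symm)
  have hI : ∀ a b, IntervalIntegrable (fun z => 1 / √(U (ζ E₀) - U z)) volume a b :=
    aux_int_sing2 U hU hev hmono hpos (ζ E₀) hz0
  have hI2 : ∀ a b, IntervalIntegrable
      (fun z => 1 / √(U (ζ E₀) - U z) * (deriv φ z - 1/2)) volume a b := fun a b =>
    (hI a b).mul_continuousOn (by fun_prop)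
  have hI3 : ∀ a b, IntervalIntegrable
      (fun z => 1 / (2 * √(U (ζ E₀) - U z)) * (1 + 2 * deriv φ z)) volume a b := fun a b => by
    refine ((hI2 a b).add (hI a b)).congr ?_
    intro z _
    show 1 / √(U (ζ E₀) - U z) * (deriv φ z - 1/2) + 1 / √(U (ζ E₀) - U z) =
      1 / (2 * √(U (ζ E₀) - U z)) * (1 + 2 * deriv φ z)
    rw [← one_div_mul_one_div]
    ring
  rw [hUz0] at hI3
  rw [← intervalIntegral.integral_add_adjacent_intervals (hI3 0 (ζ E₀)) (hI3 (ζ E₀) M)] at hu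
  have hz : ∫ z in (ζ E₀)..M, 1 / (2 * √(E₀ - U z)) * (1 + 2 * deriv φ z) = 0 := by
    rw [← intervalIntegral.integral_zero (a := ζ E₀) (b := M) (μ := volume)]
    apply intervalIntegral.integral_congr
    intro z hz
    rw [Set.uIcc_of_le (by linarith)] at hz
    simp [htail E₀ z hE₀ hz.1]
  have hs : ∫ z in (0:ℝ)..(ζ E₀), 1 / (2 * √(E₀ - U z)) * (1 + 2 * deriv φ z) =
      (∫ z in (0:ℝ)..(ζ E₀), 1 / √(U (ζ E₀) - U z) * (deriv φ z - 1/2)) +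
      ∫ z in (0:ℝ)..(ζ E₀), 1 / √(U (ζ E₀) - U z) := by
    rw [← intervalIntegral.integral_add (hI2 _ _) (hI _ _)]
    apply intervalIntegral.integral_congr
    intro z _
    simp only [hUz0]
    rw [← one_div_mul_one_div]
    ring
  rw [hz, add_zero, hs, hTs E₀ hE₀] at hu
  simp only [id] at hu
  linarith

lemma aux_J_ne (U φ : ℝ → ℝ) (hU : ContDiff ℝ 1 U) (hev : ∀ z, U (-z) = U z)
    (hmono : StrictMonoOn U (Set.Ici 0)) (hpos : ∀ z, 0 < z → 0 < deriv U z)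
    (hφ : ContDiff ℝ 1 φ) (hUφ : ∀ z, deriv U z * φ z = U z - U 0)
    (hφodd : ∀ z, φ (-z) = -φ z)
    (ζ : ℝ → ℝ) (hζ : ∀ E ∈ Set.Ioo (U 0) (0 : ℝ), 0 < ζ E ∧ U (ζ E) = E)
    (T : ℝ → ℝ)
    (hT : ∀ E ∈ Set.Ioo (U 0) (0 : ℝ),
      T E = 2 * Real.sqrt 2 * ∫ z in (0 : ℝ)..ζ E, (E - U z) ^ (-(1 / 2) : ℝ))
    (E₀ : ℝ) (hE₀ : E₀ ∈ Set.Ioo (U 0) (0 : ℝ))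
    (T' : ℝ) (hT' : HasDerivAt T T' E₀) (hT'pos : 0 < T')
    (w : ℝ → ℝ) (hw : ContDiff ℝ 2 w)
    (hweq : ∀ t : ℝ, deriv (deriv w) t = -deriv U (w t))
    (henergy : ∀ t : ℝ, 1 / 2 * (deriv w t) ^ 2 + U (w t) = E₀)
    (P : ℝ) (hPpos : 0 < P) (hP : Function.Periodic w P) (t : ℝ) :
    ∫ s in t..(t + P), (deriv φ (w s) - 1 / 2) ≠ 0 := by
  have hφ0 : φ 0 = 0 := by have := hφodd 0; rw [neg_zero] at this; linarith
  have hφc' := hφ.continuous_deriv le_rfl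
  have hwc := hw.continuous
  obtain ⟨hz0, hUz0⟩ := hζ E₀ hE₀
  have h1 := aux_T_deriv U φ hU hev hmono hpos hφ hUφ hφ0 ζ hζ T hT E₀ hE₀ T' hT'
  have hI : IntervalIntegrable (fun z => 1 / √(U (ζ E₀) - U z)) volume 0 (ζ E₀) :=
    aux_int_sing2 U hU hev hmono hpos (ζ E₀) hz0 _ _
  have hI2 : IntervalIntegrable
      (fun z => 1 / √(U (ζ E₀) - U z) * (deriv φ z - 1/2)) volume 0 (ζ E₀) :=
    hI.mul_continuousOn (by fun_prop)
  have hpos1 : 0 < ∫ z in (0:ℝ)..ζ E₀, 1 / √(U (ζ E₀) - U z) := by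
    refine intervalIntegral.intervalIntegral_pos_of_pos_on hI ?_ hz0
    intro z hz
    have := hmono (a := z) (b := ζ E₀) hz.1.le hz0.le hz.2
    have : 0 < U (ζ E₀) - U z := by linarith
    positivity
  set I1 := ∫ z in (0:ℝ)..ζ E₀, 1 / √(U (ζ E₀) - U z) with hI1
  set I2 := ∫ z in (0:ℝ)..ζ E₀, 1 / √(U (ζ E₀) - U z) * (deriv φ z - 1/2) with hI2d
  have hI2pos : 0 < I2 := by
    have h2 : 0 < (E₀ - U 0) * T' := mul_pos (by linarith [hE₀.1]) hT'pos
    rw [h1] at h2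
    exact pos_of_mul_pos_right h2 (by positivity)
  have hφe : ∀ z, deriv φ (-z) = deriv φ z := by
    intro z
    have h3 := deriv_comp_neg φ z
    have h4 : (fun x => φ (-x)) = fun x => -φ x := funext hφodd
    rw [h4, deriv.fun_neg] at h3
    linarith
  have havg := aux_time_average U hU hev hmono hpos (ζ E₀) hz0 w hw hweq
    (fun t => by rw [henergy t, hUz0]) P hP (fun z => (deriv φ z - 1/2) - I2 / I1) (by fun_prop)
    (fun z => by simp only [hφe]) (by
      simp only [mul_sub _ _ (I2 / I1)]
      rw [intervalIntegral.integral_sub hI2 (hI.mul_const _), intervalIntegral.integral_mul_const,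
        ← hI1, ← hI2d]
      field_simp
      ring) t
  rw [intervalIntegral.integral_sub
    (Continuous.intervalIntegrable (by fun_prop) _ _)
    (Continuous.intervalIntegrable (by fun_prop) _ _), intervalIntegral.integral_const] at havg
  have : 0 < P * (I2 / I1) := by positivity
  simp only [add_sub_cancel_left, smul_eq_mul] at havg
  linarith

lemma aux_main (U φ : ℝ → ℝ) (hU : ContDiff ℝ 3 U) (hev : ∀ z, U (-z) = U z)
    (hpos : ∀ z, 0 < z → 0 < deriv U z)
    (hφ : ContDiff ℝ 1 φ) (hUφ : ∀ z, deriv U z * φ z = U z - U 0)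
    (hφodd : ∀ z, φ (-z) = -φ z)
    (ζ : ℝ → ℝ) (hζ : ∀ E ∈ Set.Ioo (U 0) (0 : ℝ), 0 < ζ E ∧ U (ζ E) = E)
    (T : ℝ → ℝ)
    (hT : ∀ E ∈ Set.Ioo (U 0) (0 : ℝ),
      T E = 2 * Real.sqrt 2 * ∫ z in (0 : ℝ)..ζ E, (E - U z) ^ (-(1 / 2) : ℝ))
    (E₀ : ℝ) (hE₀ : E₀ ∈ Set.Ioo (U 0) (0 : ℝ))
    (T' : ℝ) (hT' : HasDerivAt T T' E₀) (hT'pos : 0 < T')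
    (w : ℝ → ℝ) (hw : ContDiff ℝ 2 w)
    (hwnc : ¬ ∃ c : ℝ, ∀ t : ℝ, w t = c)
    (hweq : ∀ t : ℝ, deriv (deriv w) t = -deriv U (w t))
    (henergy : ∀ t : ℝ, 1 / 2 * (deriv w t) ^ 2 + U (w t) = E₀)
    (P : ℝ) (hPpos : 0 < P) (hP : Function.Periodic w P) :
    (ContDiff ℝ 2 (deriv w) ∧ Function.Periodic (deriv w) P ∧
      (∀ t : ℝ, deriv (deriv (deriv w)) t = -(deriv (deriv U) (w t) * deriv w t))) ∧
    (¬ ∀ t : ℝ, deriv w t = 0) ∧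
    (∀ y : ℝ → ℝ, ContDiff ℝ 2 y → Function.Periodic y P →
      (∀ t : ℝ, deriv (deriv y) t = -(deriv (deriv U) (w t) * y t)) →
      ∃ c : ℝ, ∀ t : ℝ, y t = c * deriv w t) := by
  have hU' : ContDiff ℝ 2 (deriv U) :=
    (contDiff_succ_iff_deriv.1 (show ContDiff ℝ (2+1) U from by convert hU using 1; norm_num)).2.2
  have hmono : StrictMonoOn U (Set.Ici 0) :=
    strictMonoOn_of_deriv_pos (convex_Ici 0) hU.continuous.continuousOn
      (fun z hz => hpos z (by simpa using hz))
  have hφc' := hφ.continuous_deriv le_rfl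
  have hwd : Differentiable ℝ w := hw.differentiable two_ne_zero
  have hw1 : ContDiff ℝ 1 (deriv w) :=
    (contDiff_succ_iff_deriv.1 (show ContDiff ℝ (1+1) w from hw)).2.2
  have hwd1 : Differentiable ℝ (deriv w) := hw1.differentiable one_ne_zero
  have hw2eq : deriv (deriv w) = fun t => -deriv U (w t) := funext hweq
  have hcd : ContDiff ℝ 2 (deriv w) := by
    have h : ContDiff ℝ (1+1) (deriv w) := by
      rw [contDiff_succ_iff_deriv]
      refine ⟨hwd1, by simp, ?_⟩
      rw [hw2eq]
      exact ((hU'.of_le one_le_two).comp (hw.of_le one_le_two)).neg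
    exact h
  have hper' : Function.Periodic (deriv w) P := by
    intro t
    rw [← deriv_comp_add_const]
    congr 1
    exact funext hP
  have hHw : ∀ t, HasDerivAt w (deriv w t) t := fun t => (hwd t).hasDerivAt
  have hHw1 : ∀ t, HasDerivAt (deriv w) (-deriv U (w t)) t := fun t => by
    rw [← hweq]; exact (hwd1 t).hasDerivAt
  have hHU1 : ∀ z, HasDerivAt (deriv U) (deriv (deriv U) z) z := fun z =>
    (hU'.differentiable two_ne_zero z).hasDerivAt
  have hHw2 : ∀ t, HasDerivAt (fun t => -deriv U (w t)) (-(deriv (deriv U) (w t) * deriv w t)) t :=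
    fun t => ((hHU1 (w t)).comp t (hHw t)).neg
  have hnz : ¬ ∀ t : ℝ, deriv w t = 0 := fun h =>
    hwnc ⟨w 0, fun t => is_const_of_deriv_eq_zero hwd h t 0⟩
  refine ⟨⟨hcd, hper', fun t => by rw [hw2eq]; exact (hHw2 t).deriv⟩, hnz, ?_⟩
  intro y hy hyP hyeq
  have hyd : Differentiable ℝ y := hy.differentiable two_ne_zero
  have hy1 : ContDiff ℝ 1 (deriv y) :=
    (contDiff_succ_iff_deriv.1 (show ContDiff ℝ (1+1) y from hy)).2.2
  have hHy : ∀ t, HasDerivAt y (deriv y t) t := fun t => (hyd t).hasDerivAt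
  have hHy1 : ∀ t, HasDerivAt (deriv y) (-(deriv (deriv U) (w t) * y t)) t := fun t => by
    rw [← hyeq]; exact (hy1.differentiable one_ne_zero t).hasDerivAt
  -- second solution
  set J : ℝ → ℝ := fun t => ∫ s in (0:ℝ)..t, (deriv φ (w s) - 1/2) with hJ
  have hcJ : Continuous (fun s => deriv φ (w s) - 1/2) := by
    have := hw.continuous
    fun_prop
  have hHJ : ∀ t, HasDerivAt J (deriv φ (w t) - 1/2) t := fun t =>
    intervalIntegral.integral_hasDerivAt_right (hcJ.intervalIntegrable _ _)
      (hcJ.stronglyMeasurable.stronglyMeasurableAtFilter) hcJ.continuousAt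
  have hHφ : ∀ z, HasDerivAt φ (deriv φ z) z := fun z =>
    (hφ.differentiable one_ne_zero z).hasDerivAt
  have hHφw : ∀ t, HasDerivAt (fun t => φ (w t)) (deriv φ (w t) * deriv w t) t := fun t =>
    (hHφ (w t)).comp t (hHw t)
  have hrel : ∀ z, deriv (deriv U) z * φ z + deriv U z * deriv φ z = deriv U z := by
    intro z
    have h1 := (hHU1 z).mul (hHφ z)
    have h2 : HasDerivAt (fun z => U z - U 0) (deriv U z) z :=
      ((hU.differentiable (by norm_num) z).hasDerivAt).sub_const _
    have h3 : (deriv U * φ) = fun z => U z - U 0 := funext hUφ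
    rw [h3] at h1
    exact h1.unique h2
  set y₀ : ℝ → ℝ := fun t => φ (w t) - deriv w t * J t with hy₀
  set y₁ : ℝ → ℝ := fun t => deriv w t / 2 + deriv U (w t) * J t with hy₁
  have hHy₀ : ∀ t, HasDerivAt y₀ (y₁ t) t := fun t => by
    refine ((hHφw t).sub ((hHw1 t).mul (hHJ t))).congr_deriv ?_
    simp only [hy₁]; ring
  have hHUw : ∀ t, HasDerivAt (fun t => deriv U (w t)) (deriv (deriv U) (w t) * deriv w t) t :=
    fun t => (hHU1 (w t)).comp t (hHw t)
  have hHy₁ : ∀ t, HasDerivAt y₁ (-(deriv (deriv U) (w t) * y₀ t)) t := fun t => by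
    refine (((hHw1 t).div_const 2).add ((hHUw t).mul (hHJ t))).congr_deriv ?_
    simp only [hy₀]
    linear_combination hrel (w t)
  -- Wronskians
  have hconst : ∀ (f : ℝ → ℝ), (∀ t, HasDerivAt f 0 t) → ∀ t, f t = f 0 := fun f hf t =>
    is_const_of_deriv_eq_zero (fun t => (hf t).differentiableAt) (fun t => (hf t).deriv) t 0
  set A : ℝ → ℝ := fun t => y t * (-deriv U (w t)) - deriv y t * deriv w t with hA
  set B : ℝ → ℝ := fun t => y t * y₁ t - deriv y t * y₀ t with hB
  have hAc := hconst A (fun t => by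
    refine (((hHy t).mul (hHw2 t)).sub ((hHy1 t).mul (hHw1 t))).congr_deriv ?_
    ring)
  have hBc := hconst B (fun t => by
    refine (((hHy t).mul (hHy₁ t)).sub ((hHy1 t).mul (hHy₀ t))).congr_deriv ?_
    ring)
  have hW : ∀ t, y₀ t * (-deriv U (w t)) - y₁ t * deriv w t = -(E₀ - U 0) := by
    intro t
    simp only [hy₀, hy₁]
    linear_combination (-1 : ℝ) * hUφ (w t) - henergy t
  have he : 0 < E₀ - U 0 := by linarith [hE₀.1]
  have hrep : ∀ t, (E₀ - U 0) * y t = - A 0 * y₀ t + B 0 * deriv w t := by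
    intro t
    rw [← hAc t, ← hBc t]
    simp only [hA, hB]
    linear_combination (y t) * hW t
  by_cases hA0 : A 0 = 0
  · refine ⟨B 0 / (E₀ - U 0), fun t => ?_⟩
    have := hrep t
    rw [hA0] at this
    field_simp
    linarith
  · exfalso
    push Not at hnz
    obtain ⟨t, ht⟩ := hnz
    have h1 := hrep t
    have h2 := hrep (t + P)
    rw [hyP t, hper' t, h1] at h2
    have h3 : y₀ (t + P) = y₀ t := by
      have : A 0 * (y₀ (t+P) - y₀ t) = 0 := by linarith
      rcases mul_eq_zero.1 this with h | h
      · exact absurd h hA0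
      · linarith
    simp only [hy₀] at h3
    rw [hP t, hper' t] at h3
    have h4 : deriv w t * (J (t + P) - J t) = 0 := by linarith
    have h5 := (mul_eq_zero.1 h4).resolve_left ht
    have h6 : J (t + P) - J t = ∫ s in t..(t+P), (deriv φ (w s) - 1/2) :=
      intervalIntegral.integral_interval_sub_left (hcJ.intervalIntegrable _ _)
        (hcJ.intervalIntegrable _ _)
    exact aux_J_ne U φ (hU.of_le (by norm_num)) hev hmono hpos hφ hUφ hφodd ζ hζ T hT E₀ hE₀ T' hT'
      hT'pos w hw hweq henergy P hPpos hP t (h6 ▸ h5)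

/-- Nondegeneracy of the variational equation: if `w` is a
nonconstant `2π𝔮`-periodic solution of `ẅ = -U₀'(w)` of energy `E₀` with minimal
period `T(E₀)`, and the period function is differentiable at `E₀` with `T'(E₀) > 0`,
then the space of `2π𝔮`-periodic solutions of `ÿ = -U₀''(w(t)) y` is one-dimensional,
spanned by `ẇ`. -/
theorem variational_equation_kernel_one_dimensional
    (n : ℕ) (hn : 1 ≤ n)
    (m βv : Fin n → ℝ) (hm : ∀ j, 0 < m j) (hβv : ∀ j, 0 < βv j)
    (U₀ : ℝ → ℝ)
    (hU₀ : ∀ z : ℝ, U₀ z = -∑ j, m j / Real.sqrt (z ^ 2 + βv j ^ 2))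
    (Emin : ℝ) (hEmin : Emin = U₀ 0)
    (ζ : ℝ → ℝ)
    (hζ : ∀ E ∈ Set.Ioo Emin (0 : ℝ), 0 < ζ E ∧ U₀ (ζ E) = E)
    (T : ℝ → ℝ)
    (hT : ∀ E ∈ Set.Ioo Emin (0 : ℝ),
      T E = 2 * Real.sqrt 2 * ∫ z in (0 : ℝ)..ζ E, (E - U₀ z) ^ (-(1 / 2) : ℝ))
    (𝔮 : ℕ) (h𝔮 : 0 < 𝔮)
    (w : ℝ → ℝ) (hw : ContDiff ℝ 2 w)
    (hwnc : ¬ ∃ c : ℝ, ∀ t : ℝ, w t = c)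
    (hweq : ∀ t : ℝ, deriv (deriv w) t = -deriv U₀ (w t))
    (hw0 : deriv w 0 = 0)
    (E₀ : ℝ) (hE₀ : E₀ ∈ Set.Ioo Emin (0 : ℝ))
    (henergy : ∀ t : ℝ, 1 / 2 * (deriv w t) ^ 2 + U₀ (w t) = E₀)
    (hwperT : Function.Periodic w (T E₀))
    (hwmin : ∀ s : ℝ, 0 < s → Function.Periodic w s → T E₀ ≤ s)
    (hwper : Function.Periodic w (2 * π * 𝔮))
    (T' : ℝ) (hT' : HasDerivAt T T' E₀) (hT'pos : 0 < T') :
    (ContDiff ℝ 2 (deriv w) ∧ Function.Periodic (deriv w) (2 * π * 𝔮) ∧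
      (∀ t : ℝ, deriv (deriv (deriv w)) t = -(deriv (deriv U₀) (w t) * deriv w t))) ∧
    (¬ ∀ t : ℝ, deriv w t = 0) ∧
    (∀ y : ℝ → ℝ, ContDiff ℝ 2 y → Function.Periodic y (2 * π * 𝔮) →
      (∀ t : ℝ, deriv (deriv y) t = -(deriv (deriv U₀) (w t) * y t)) →
      ∃ c : ℝ, ∀ t : ℝ, y t = c * deriv w t) := by
  subst hEmin
  have hq : ∀ j z, 0 < z ^ 2 + βv j ^ 2 := fun j z => by have := hβv j; positivity
  have hS : ∀ j z, 0 < √(z ^ 2 + βv j ^ 2) := fun j z => Real.sqrt_pos.2 (hq j z)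
  have hSc : ∀ j, ContDiff ℝ 3 (fun z : ℝ => √(z ^ 2 + βv j ^ 2)) := fun j =>
    ContDiff.sqrt (by fun_prop) (fun z => (hq j z).ne')
  have hne : (Finset.univ : Finset (Fin n)).Nonempty := ⟨⟨0, hn⟩, Finset.mem_univ _⟩
  set p : ℝ → ℝ := fun z => ∑ j, m j / √(z ^ 2 + βv j ^ 2) ^ 3 with hp
  set k : ℝ → ℝ := fun z =>
    ∑ j, m j / (βv j * √(z ^ 2 + βv j ^ 2) * (√(z ^ 2 + βv j ^ 2) + βv j)) with hk
  have hppos : ∀ z, 0 < p z := fun z => Finset.sum_pos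
    (fun j _ => div_pos (hm j) (pow_pos (hS j z) 3)) hne
  have hUc : ContDiff ℝ 3 U₀ := by
    rw [funext hU₀]
    exact (ContDiff.sum fun j _ => contDiff_const.div (hSc j) (fun z => (hS j z).ne')).neg
  have hpc : ContDiff ℝ 3 p :=
    ContDiff.sum fun j _ => contDiff_const.div ((hSc j).pow 3) (fun z => (pow_pos (hS j z) 3).ne')
  have hkc : ContDiff ℝ 3 k :=
    ContDiff.sum fun j _ => contDiff_const.div ((contDiff_const.mul (hSc j)).mul
      ((hSc j).add contDiff_const)) (fun z => by
        have := hS j z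
        have := hβv j
        positivity)
  have hU' : ∀ z, deriv U₀ z = z * p z := by
    intro z
    have h : HasDerivAt U₀ (-∑ j, -(m j * (z / √(z ^ 2 + βv j ^ 2))) / √(z ^ 2 + βv j ^ 2) ^ 2) z := by
      rw [funext hU₀]
      refine (HasDerivAt.fun_sum fun j _ => ?_).neg
      have h1 : HasDerivAt (fun z : ℝ => √(z ^ 2 + βv j ^ 2)) (z / √(z ^ 2 + βv j ^ 2)) z := by
        refine ((((hasDerivAt_id z).pow 2).add_const (βv j ^ 2)).sqrt (hq j z).ne').congr_deriv ?_
        have := hS j z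
        simp
        field_simp
      refine ((hasDerivAt_const z (m j)).div h1 (hS j z).ne').congr_deriv ?_
      simp
    rw [h.deriv, hp, Finset.mul_sum, ← Finset.sum_neg_distrib]
    refine Finset.sum_congr rfl fun j _ => ?_
    have := hS j z
    field_simp
  have hUk : ∀ z, U₀ z - U₀ 0 = z ^ 2 * k z := by
    intro z
    rw [hU₀, hU₀, hk, Finset.mul_sum, neg_sub_neg, ← Finset.sum_sub_distrib]
    refine Finset.sum_congr rfl fun j _ => ?_
    have h1 := hS j z
    have h2 := hβv j
    have h3 := Real.sq_sqrt (hq j z).le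
    have h4 : √((0:ℝ) ^ 2 + βv j ^ 2) = βv j := by
      rw [zero_pow two_ne_zero, zero_add, Real.sqrt_sq h2.le]
    rw [h4]
    set S := √(z ^ 2 + βv j ^ 2)
    have h5 : S + βv j ≠ 0 := by positivity
    field_simp
    linear_combination m j * h3
  refine aux_main U₀ (fun z => z * k z / p z) hUc (fun z => by rw [hU₀, hU₀, neg_sq])
    (fun z hz => by rw [hU']; exact mul_pos hz (hppos z))
    (((contDiff_id.mul hkc).div hpc (fun z => (hppos z).ne')).of_le (by norm_num))
    (fun z => ?_) (fun z => ?_) ζ hζ T hT E₀ hE₀ T' hT' hT'pos w hw hwnc hweq henergy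
    (2 * π * 𝔮) (by positivity) hwper
  · have := (hppos z).ne'
    rw [hU', hUk]
    field_simp
  · simp only [hp, hk, neg_sq]
    ring
end
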